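/- Let I ⊂ ℝ be a compact interval, f = (f₁,…,f_n) : I → ℝⁿ a C^(n) map whose Wronskian det(f_i^(j)(x))_{1≤i,j≤n} is nonzero for every x ∈ I, let ψ be an approximation function with lower order τ_ψ ≥ n, and λ ∈ C²(I). Then the Hausdorff dimension of A_n(ψ,λ) is at least (n+1)/(τ_ψ+1). -/

import Mathlib

open MeasureTheory Filter Set

/-- Distance from a real number to the nearest integer. -/
noncomputable def nearestIntDist (x : ℝ) : ℝ := |x - round x|

/-- A bounded set of reals either contains `m + 1` points with gaps at least `Δ`, or has
measure at most `2 m Δ`. -/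
lemma exists_separated_or_volume_le (m : ℕ) {Δ : ℝ} (hΔ : 0 < Δ) (A : Set ℝ)
    (hA : BddBelow A) :
    (∃ x : ℕ → ℝ, (∀ i ≤ m, x i ∈ A) ∧ ∀ i < m, x i + Δ ≤ x (i + 1)) ∨
      volume A ≤ ENNReal.ofReal (2 * m * Δ) := by
  induction m generalizing A with
  | zero =>
    rcases A.eq_empty_or_nonempty with rfl | ⟨x, hx⟩
    · right; simp
    · exact Or.inl ⟨fun _ => x, fun _ _ => hx, by simp⟩
  | succ m ih =>
    rcases A.eq_empty_or_nonempty with rfl | hne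
    · right; simp
    obtain ⟨x₀, hx₀, hlt⟩ := exists_lt_of_csInf_lt hne (lt_add_of_pos_right (sInf A) hΔ)
    rcases ih (A ∩ Ici (x₀ + Δ)) (hA.mono inter_subset_left) with ⟨x, hx, hgap⟩ | hvol
    · left
      refine ⟨fun i => Nat.casesOn i x₀ x, ?_, ?_⟩
      · rintro (_ | i) hi
        · exact hx₀
        · exact (hx i (by omega)).1
      · rintro (_ | i) hi
        · exact (hx 0 (Nat.zero_le _)).2
        · exact hgap i (by omega)
    · right
      have hsub : A ⊆ Icc (sInf A) (x₀ + Δ) ∪ (A ∩ Ici (x₀ + Δ)) := by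
        intro y hy
        rcases le_total y (x₀ + Δ) with h | h
        · exact Or.inl ⟨csInf_le hA hy, h⟩
        · exact Or.inr ⟨hy, h⟩
      calc volume A ≤ volume (Icc (sInf A) (x₀ + Δ)) + volume (A ∩ Ici (x₀ + Δ)) :=
            (measure_mono hsub).trans (measure_union_le _ _)
        _ ≤ ENNReal.ofReal (2 * Δ) + ENNReal.ofReal (2 * m * Δ) := by
            gcongr
            rw [Real.volume_Icc]
            exact ENNReal.ofReal_le_ofReal (by linarith)
        _ = ENNReal.ofReal (2 * (m + 1 : ℕ) * Δ) := by
            rw [← ENNReal.ofReal_add (by positivity) (by positivity)]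
            congr 1; push_cast; ring

/-- A `δ`-separated finite set in a ball of radius `R` has at most `2 R / δ + 1` points. -/
lemma card_le_of_separated {δ R z : ℝ} (hδ : 0 < δ) (hR : 0 ≤ R) (X : Finset ℝ)
    (hsep : ∀ x ∈ X, ∀ y ∈ X, x ≠ y → δ ≤ |x - y|) (hX : ∀ x ∈ X, |x - z| ≤ R) :
    (X.card : ℝ) ≤ 2 * R / δ + 1 := by
  set g : ℝ → ℕ := fun x => ⌊(x - (z - R)) / δ⌋₊ with hg
  have hnonneg : ∀ x ∈ X, 0 ≤ (x - (z - R)) / δ := fun x hx => by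
    have := abs_le.1 (hX x hx)
    exact div_nonneg (by linarith) hδ.le
  have hmaps : ∀ x ∈ X, g x ∈ Finset.range (⌊2 * R / δ⌋₊ + 1) := fun x hx => by
    rw [Finset.mem_range, Nat.lt_succ_iff]
    apply Nat.floor_le_floor
    have := abs_le.1 (hX x hx)
    gcongr
    linarith
  have hinj : Set.InjOn g X := by
    intro x hx y hy hxy
    by_contra hne
    have h1 := hsep x hx y hy hne
    have a1 := Nat.floor_le (hnonneg x hx)
    have a2 := Nat.lt_floor_add_one ((x - (z - R)) / δ)
    have b1 := Nat.floor_le (hnonneg y hy)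
    have b2 := Nat.lt_floor_add_one ((y - (z - R)) / δ)
    have hxy' : ((⌊(x - (z - R)) / δ⌋₊ : ℕ) : ℝ) = ⌊(y - (z - R)) / δ⌋₊ := by
      exact_mod_cast hxy
    rw [hxy'] at a1 a2
    have : |(x - (z - R)) / δ - (y - (z - R)) / δ| < 1 := abs_lt.2 ⟨by linarith, by linarith⟩
    rw [← sub_div, abs_div, abs_of_pos hδ, div_lt_one hδ] at this
    have h3 : x - (z - R) - (y - (z - R)) = x - y := by ring
    rw [h3] at this
    linarith
  have hcard := Finset.card_le_card_of_injOn g hmaps hinj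
  rw [Finset.card_range] at hcard
  calc (X.card : ℝ) ≤ (⌊2 * R / δ⌋₊ + 1 : ℕ) := by exact_mod_cast hcard
    _ ≤ 2 * R / δ + 1 := by
      push_cast
      gcongr
      exact Nat.floor_le (by positivity)

/-- The balls `closedBall (z i) (d i)` meeting `closedBall y r` have small total `s`-dimensional
size, relative to `r`. -/
def LightOn (z d : ℕ → ℝ) (s θ y r : ℝ) : Prop :=
  ∀ T : Finset ℕ,
    (∀ i ∈ T, (Metric.closedBall (z i) (d i) ∩ Metric.closedBall y r).Nonempty) →
      ∑ i ∈ T, d i ^ s ≤ (θ * r) ^ s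

lemma LightOn.exists_step {z d : ℕ → ℝ} (hd : ∀ i, 0 < d i) {s t κ y r δ : ℝ} (hs : 0 < s)
    (ht : 1 ≤ t) (hst : s * t < 1) (hκ : 0 < κ) (hr : 0 < r)
    (hL : LightOn z d s (κ / 10) y r) (hδ : 0 < δ) (hδ1 : δ < 1)
    (hδr : 10 * r ^ s * δ ^ (1 - s * t) < κ * r) (X : Finset ℝ)
    (hsep : ∀ x ∈ X, ∀ x' ∈ X, x ≠ x' → δ ≤ |x - x'|) (hcard : κ * r ≤ X.card * δ)
    (hX : ∀ x ∈ X, Metric.closedBall x (δ ^ t) ⊆ Metric.closedBall y r) :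
    ∃ x ∈ X, LightOn z d s (κ / 10) x (δ ^ t) := by
  classical
  set θ : ℝ := κ / 10 with hθdef
  have hθ : 0 < θ := by positivity
  have hs1 : s ≤ 1 := by nlinarith
  have hρ : 0 < δ ^ t := Real.rpow_pos_of_pos hδ t
  have hρδ : δ ^ t ≤ δ := by
    calc δ ^ t ≤ δ ^ (1 : ℝ) := Real.rpow_le_rpow_of_exponent_ge hδ hδ1.le ht
      _ = δ := Real.rpow_one δ
  set meets : ℕ → ℝ → Prop := fun i x =>
    (Metric.closedBall (z i) (d i) ∩ Metric.closedBall x (δ ^ t)).Nonempty with hmeets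
  have hmeetsY : ∀ x ∈ X, ∀ i, meets i x →
      (Metric.closedBall (z i) (d i) ∩ Metric.closedBall y r).Nonempty := fun x hx i hi =>
    hi.mono (inter_subset_inter_right _ (hX x hx))
  have hcount : ∀ i, ((X.filter (meets i)).card : ℝ) ≤ 2 * d i / δ + 3 := by
    intro i
    have h := card_le_of_separated (z := z i) hδ (R := d i + δ) (by linarith [hd i])
      (X.filter (meets i))
      (fun x hx x' hx' => hsep x (Finset.mem_filter.1 hx).1 x' (Finset.mem_filter.1 hx').1) ?_
    · refine h.trans (le_of_eq ?_)
      field_simp; ring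
    · intro x hx
      obtain ⟨w, hw1, hw2⟩ := (Finset.mem_filter.1 hx).2
      rw [Metric.mem_closedBall, Real.dist_eq] at hw1 hw2
      calc |x - z i| = |(w - z i) - (w - x)| := by congr 1; ring
        _ ≤ |w - z i| + |w - x| := abs_sub _ _
        _ ≤ d i + δ := by linarith
  have hdle : ∀ x ∈ X, ∀ i, meets i x → d i ≤ θ * r := by
    intro x hx i hi
    have := hL {i} (by simpa using hmeetsY x hx i hi)
    rw [Finset.sum_singleton] at this
    exact (Real.rpow_le_rpow_iff (hd i).le (by positivity) hs).1 this
  have hsumd : ∀ T : Finset ℕ, (∀ i ∈ T, ∃ x ∈ X, meets i x) → ∑ i ∈ T, d i ≤ θ * r := by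
    intro T hT
    have h1 : ∀ i ∈ T, d i ≤ d i ^ s * (θ * r) ^ (1 - s) := by
      intro i hi
      obtain ⟨x, hx, hix⟩ := hT i hi
      calc d i = d i ^ s * d i ^ (1 - s) := by
            rw [← Real.rpow_add (hd i)]; simp
        _ ≤ _ := by
            have := Real.rpow_le_rpow (hd i).le (hdle x hx i hix) (sub_nonneg.2 hs1)
            exact mul_le_mul_of_nonneg_left this (Real.rpow_nonneg (hd i).le _)
    have h2 := hL T (fun i hi => by
      obtain ⟨x, hx, hix⟩ := hT i hi
      exact hmeetsY x hx i hix)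
    calc ∑ i ∈ T, d i ≤ ∑ i ∈ T, d i ^ s * (θ * r) ^ (1 - s) := Finset.sum_le_sum h1
      _ = (∑ i ∈ T, d i ^ s) * (θ * r) ^ (1 - s) := (Finset.sum_mul _ _ _).symm
      _ ≤ (θ * r) ^ s * (θ * r) ^ (1 - s) :=
          mul_le_mul_of_nonneg_right h2 (Real.rpow_nonneg (by positivity) _)
      _ = θ * r := by rw [← Real.rpow_add (by positivity)]; simp
  set bad : Finset ℝ := X.filter (fun x => ∃ i, δ ≤ d i ∧ meets i x) with hbad
  set G : Finset ℝ := X.filter (fun x => ¬ ∃ i, δ ≤ d i ∧ meets i x) with hG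
  have hbadcard : (bad.card : ℝ) * δ ≤ 5 * θ * r := by
    have hex : ∀ x ∈ bad, ∃ i, δ ≤ d i ∧ meets i x := fun x hx => (Finset.mem_filter.1 hx).2
    choose! ι hι using hex
    have hsub : bad ⊆ (bad.image ι).biUnion fun i => X.filter (meets i) := by
      intro x hx
      rw [Finset.mem_biUnion]
      exact ⟨ι x, Finset.mem_image_of_mem _ hx,
        Finset.mem_filter.2 ⟨(Finset.mem_filter.1 hx).1, (hι x hx).2⟩⟩
    have hle : (bad.card : ℝ) ≤ ∑ i ∈ bad.image ι, ((X.filter (meets i)).card : ℝ) := by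
      exact_mod_cast (Finset.card_le_card hsub).trans Finset.card_biUnion_le
    have hle2 : ∑ i ∈ bad.image ι, ((X.filter (meets i)).card : ℝ) ≤
        ∑ i ∈ bad.image ι, 5 / δ * d i := by
      refine Finset.sum_le_sum fun i hi => (hcount i).trans ?_
      obtain ⟨x, hx, rfl⟩ := Finset.mem_image.1 hi
      have := (hι x hx).1
      have h1 : 1 ≤ d (ι x) / δ := (one_le_div hδ).2 this
      calc 2 * d (ι x) / δ + 3 = 2 * (d (ι x) / δ) + 3 := by ring
        _ ≤ 5 * (d (ι x) / δ) := by linarith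
        _ = _ := by ring
    rw [← Finset.mul_sum] at hle2
    have hle3 := hsumd (bad.image ι) (fun i hi => by
      obtain ⟨x, hx, rfl⟩ := Finset.mem_image.1 hi
      exact ⟨x, (Finset.mem_filter.1 hx).1, (hι x hx).2⟩)
    calc (bad.card : ℝ) * δ ≤ (5 / δ * ∑ i ∈ bad.image ι, d i) * δ := by
          gcongr; exact hle.trans hle2
      _ = 5 * ∑ i ∈ bad.image ι, d i := by field_simp
      _ ≤ 5 * θ * r := by linarith
  have hGcard : κ * r / 2 ≤ G.card * δ := by
    have h : (bad.card : ℝ) + G.card = X.card := by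
      exact_mod_cast Finset.card_filter_add_card_filter_not _
    have : κ * r ≤ (bad.card + G.card : ℝ) * δ := by rw [h]; exact hcard
    have h5 : 5 * θ * r = κ * r / 2 := by rw [hθdef]; ring
    nlinarith
  by_contra! hcon
  have hfail : ∀ x ∈ G, ∃ T : Finset ℕ, (∀ i ∈ T, meets i x) ∧
      (θ * δ ^ t) ^ s < ∑ i ∈ T, d i ^ s := by
    intro x hx
    have := hcon x (Finset.mem_filter.1 hx).1
    simp only [LightOn] at this
    push Not at this
    exact this
  choose! T hT1 hT2 using hfail
  have hsum1 : (G.card : ℝ) * (θ * δ ^ t) ^ s ≤ ∑ x ∈ G, ∑ i ∈ T x, d i ^ s := by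
    rw [← nsmul_eq_mul]
    exact Finset.card_nsmul_le_sum _ _ _ fun x hx => (hT2 x hx).le
  have hswap : ∑ x ∈ G, ∑ i ∈ T x, d i ^ s =
      ∑ i ∈ G.biUnion T, ∑ x ∈ G.filter (fun x => i ∈ T x), d i ^ s := by
    refine Finset.sum_comm' fun x i => ?_
    simp only [Finset.mem_filter, Finset.mem_biUnion]
    exact ⟨fun h => ⟨h, x, h⟩, fun h => h.1⟩
  have hsum2 : ∑ i ∈ G.biUnion T, ∑ x ∈ G.filter (fun x => i ∈ T x), d i ^ s ≤
      ∑ i ∈ G.biUnion T, 5 * d i ^ s := by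
    refine Finset.sum_le_sum fun i hi => ?_
    rw [Finset.sum_const, nsmul_eq_mul]
    refine mul_le_mul_of_nonneg_right ?_ (Real.rpow_nonneg (hd i).le _)
    obtain ⟨x, hx, hix⟩ := Finset.mem_biUnion.1 hi
    have hsmall : d i < δ := by
      by_contra! hge
      exact (Finset.mem_filter.1 hx).2 ⟨i, hge, hT1 x hx i hix⟩
    have hsub : G.filter (fun x => i ∈ T x) ⊆ X.filter (meets i) := fun x hx => by
      obtain ⟨hx1, hx2⟩ := Finset.mem_filter.1 hx
      exact Finset.mem_filter.2 ⟨(Finset.mem_filter.1 hx1).1, hT1 x hx1 i hx2⟩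
    have h1 : d i / δ < 1 := (div_lt_one hδ).2 hsmall
    calc ((G.filter (fun x => i ∈ T x)).card : ℝ) ≤ (X.filter (meets i)).card := by
          exact_mod_cast Finset.card_le_card hsub
      _ ≤ 2 * d i / δ + 3 := hcount i
      _ = 2 * (d i / δ) + 3 := by ring
      _ ≤ 5 := by linarith
  have hsum3 : ∑ i ∈ G.biUnion T, d i ^ s ≤ (θ * r) ^ s := hL _ fun i hi => by
    obtain ⟨x, hx, hix⟩ := Finset.mem_biUnion.1 hi
    exact hmeetsY x (Finset.mem_filter.1 hx).1 i (hT1 x hx i hix)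
  rw [← Finset.mul_sum] at hsum2
  have hmain : (G.card : ℝ) * (θ * δ ^ t) ^ s ≤ 5 * (θ * r) ^ s := by linarith
  rw [Real.mul_rpow hθ.le hρ.le, Real.mul_rpow hθ.le hr.le, ← Real.rpow_mul hδ.le] at hmain
  have hθs : 0 < θ ^ s := Real.rpow_pos_of_pos hθ s
  have hmain' : (G.card : ℝ) * δ ^ (t * s) ≤ 5 * r ^ s := by
    refine le_of_mul_le_mul_left ?_ hθs
    linarith
  have hδts : 0 < δ ^ (1 - s * t) := Real.rpow_pos_of_pos hδ _
  have hprod : δ ^ (t * s) * δ ^ (1 - s * t) = δ := by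
    rw [← Real.rpow_add hδ]
    have : t * s + (1 - s * t) = 1 := by ring
    rw [this, Real.rpow_one]
  have : (G.card : ℝ) * δ ≤ 5 * r ^ s * δ ^ (1 - s * t) := by
    calc (G.card : ℝ) * δ = (G.card * δ ^ (t * s)) * δ ^ (1 - s * t) := by
          rw [mul_assoc, hprod]
      _ ≤ _ := by gcongr
  linarith

/-- A lower bound for the Hausdorff dimension of a limsup set satisfying a local ubiquity
condition. -/
theorem le_dimH_of_ubiquity {W : ℕ → Set ℝ} {x₀ r₀ κ t : ℝ} (hr₀ : 0 < r₀) (hκ : 0 < κ)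
    (ht : 1 ≤ t)
    (H : ∀ (k : ℕ) (y r : ℝ), 0 < r → Metric.closedBall y r ⊆ Metric.closedBall x₀ r₀ →
      ∀ δ₀ > 0, ∃ δ, 0 < δ ∧ δ < δ₀ ∧ ∃ X : Finset ℝ,
        (∀ x ∈ X, ∀ x' ∈ X, x ≠ x' → δ ≤ |x - x'|) ∧ κ * r ≤ X.card * δ ∧
          ∀ x ∈ X, Metric.closedBall x (δ ^ t) ⊆ Metric.closedBall y r ∩ W k) :
    ENNReal.ofReal (1 / t) ≤ dimH (Metric.closedBall x₀ r₀ ∩ ⋂ k, W k) := by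
  by_contra! hlt
  obtain ⟨s, hs1, hs2⟩ := ENNReal.lt_iff_exists_nnreal_btwn.1 hlt
  have hs : 0 < (s : ℝ) := by
    have : (0 : ENNReal) < s := lt_of_le_of_lt zero_le hs1
    exact_mod_cast this
  have hst : (s : ℝ) * t < 1 := by
    rw [← ENNReal.ofReal_coe_nnreal, ENNReal.ofReal_lt_ofReal_iff (by positivity)] at hs2
    rwa [lt_div_iff₀ (by linarith)] at hs2
  have hzero := hausdorffMeasure_of_dimH_lt hs1
  set θ : ℝ := κ / 10 with hθdef
  have hθ : 0 < θ := by positivity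
  set c : ℝ := (θ * r₀) ^ (s : ℝ) / 2 with hc
  have hcpos : 0 < c := by
    have := Real.rpow_pos_of_pos (mul_pos hθ hr₀) (s : ℝ)
    positivity
  have hcE : (0 : ENNReal) < ENNReal.ofReal c := ENNReal.ofReal_pos.2 hcpos
  obtain ⟨V, hV, hVsum⟩ : ∃ V : ℕ → Set ℝ,
      Metric.closedBall x₀ r₀ ∩ ⋂ k, W k ⊆ ⋃ n, V n ∧
        ∑' n, ⨆ (_ : (V n).Nonempty), Metric.ediam (V n) ^ (s : ℝ) < ENNReal.ofReal c := by
    rw [Measure.hausdorffMeasure_apply] at hzero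
    have h1 := lt_of_le_of_lt
      (le_iSup₂ (f := fun (r : ENNReal) (_ : 0 < r) => ⨅ (t : ℕ → Set ℝ),
        ⨅ (_ : Metric.closedBall x₀ r₀ ∩ ⋂ k, W k ⊆ ⋃ n, t n),
          ⨅ (_ : ∀ (n : ℕ), Metric.ediam (t n) ≤ r),
            ∑' (n : ℕ), ⨆ (_ : (t n).Nonempty), Metric.ediam (t n) ^ (s : ℝ)) 1 one_pos)
      (hzero.trans_lt hcE)
    simp only [iInf_lt_iff] at h1
    obtain ⟨V, hV, -, h⟩ := h1
    exact ⟨V, hV, h⟩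
  obtain ⟨e, he, hesum⟩ := ENNReal.exists_pos_sum_of_countable hcE.ne' ℕ
  set D : ℕ → ENNReal := fun n => ⨆ (_ : (V n).Nonempty), Metric.ediam (V n) ^ (s : ℝ) with hD
  have hDtop : ∀ n, D n ≠ ⊤ := ENNReal.ne_top_of_tsum_ne_top (hVsum.trans ENNReal.ofReal_lt_top).ne
  set d : ℕ → ℝ := fun n => ((D n).toReal + e n) ^ (1 / (s : ℝ)) with hddef
  have hepos : ∀ n, (0 : ℝ) < e n := fun n => he n
  have hbase : ∀ n, 0 < (D n).toReal + e n := fun n =>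
    add_pos_of_nonneg_of_pos ENNReal.toReal_nonneg (hepos n)
  have hd : ∀ n, 0 < d n := fun n => Real.rpow_pos_of_pos (hbase n) _
  have hds : ∀ n, d n ^ (s : ℝ) = (D n).toReal + e n := fun n => by
    rw [hddef]
    simp only
    rw [← Real.rpow_mul (hbase n).le, one_div_mul_cancel hs.ne', Real.rpow_one]
  have hz : ∀ n, ∃ z, V n ⊆ Metric.closedBall z (d n) := by
    intro n
    rcases (V n).eq_empty_or_nonempty with h | ⟨z, hz⟩
    · exact ⟨0, by simp [h]⟩
    refine ⟨z, fun x hx => ?_⟩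
    have hDn : D n = Metric.ediam (V n) ^ (s : ℝ) := by
      simp only [hD]; exact iSup_pos ⟨z, hz⟩
    have h1 : edist x z ^ (s : ℝ) ≤ D n := by
      rw [hDn]
      exact ENNReal.rpow_le_rpow (Metric.edist_le_ediam_of_mem hx hz) hs.le
    rw [Metric.mem_closedBall, ← Real.rpow_le_rpow_iff dist_nonneg (hd n).le hs, hds]
    have h2 := ENNReal.toReal_mono (hDtop n) h1
    rw [← ENNReal.toReal_rpow, ← dist_edist] at h2
    linarith [hepos n]
  choose z hz using hz
  have hbaseL : LightOn z d s θ x₀ r₀ := by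
    intro T _
    have h1 : ∑ i ∈ T, (D i).toReal ≤ c := by
      rw [← ENNReal.toReal_sum fun i _ => hDtop i]
      refine ENNReal.toReal_le_of_le_ofReal hcpos.le ?_
      exact (ENNReal.sum_le_tsum T).trans hVsum.le
    have h2 : ∑ i ∈ T, (e i : ℝ) ≤ c := by
      have : ∑ i ∈ T, ((e i : ENNReal)).toReal ≤ c := by
        rw [← ENNReal.toReal_sum fun i _ => ENNReal.coe_ne_top]
        refine ENNReal.toReal_le_of_le_ofReal hcpos.le ?_
        exact (ENNReal.sum_le_tsum T).trans hesum.le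
      simpa using this
    calc ∑ i ∈ T, d i ^ (s : ℝ) = ∑ i ∈ T, (D i).toReal + ∑ i ∈ T, (e i : ℝ) := by
          rw [← Finset.sum_add_distrib]; exact Finset.sum_congr rfl fun i _ => hds i
      _ ≤ c + c := add_le_add h1 h2
      _ = _ := by rw [hc]; ring
  have hstep : ∀ (k : ℕ) (p : ℝ × ℝ), (0 < p.2 ∧
      Metric.closedBall p.1 p.2 ⊆ Metric.closedBall x₀ r₀ ∧ LightOn z d s θ p.1 p.2) →
      ∃ p' : ℝ × ℝ, (0 < p'.2 ∧
        Metric.closedBall p'.1 p'.2 ⊆ Metric.closedBall x₀ r₀ ∧ LightOn z d s θ p'.1 p'.2) ∧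
        p'.2 ≤ p.2 / 2 ∧
        Metric.closedBall p'.1 p'.2 ⊆ Metric.closedBall p.1 p.2 ∩ W k := by
    rintro k ⟨y, r⟩ ⟨hr, hsub, hL⟩
    simp only at hr hsub hL ⊢
    have hexp : 0 < 1 - (s : ℝ) * t := by linarith
    have hrs : 0 < r ^ (s : ℝ) := Real.rpow_pos_of_pos hr _
    set η : ℝ := κ * r / (10 * r ^ (s : ℝ)) with hη
    have hηpos : 0 < η := by positivity
    obtain ⟨δ, hδ, hδ₀, X, hsep, hcard, hX⟩ := H k y r hr hsub
      (min (min 1 (r / 2)) (η ^ (1 / (1 - (s : ℝ) * t))))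
      (lt_min (lt_min one_pos (by positivity)) (Real.rpow_pos_of_pos hηpos _))
    have hδ1 : δ < 1 := hδ₀.trans_le ((min_le_left _ _).trans (min_le_left _ _))
    have hδ2 : δ < r / 2 := hδ₀.trans_le ((min_le_left _ _).trans (min_le_right _ _))
    have hδ3 : δ ^ (1 - (s : ℝ) * t) < η := by
      have := Real.rpow_lt_rpow hδ.le (hδ₀.trans_le (min_le_right _ _)) hexp
      rwa [← Real.rpow_mul hηpos.le, one_div_mul_cancel hexp.ne', Real.rpow_one] at this
    have hρδ : δ ^ t ≤ δ := by
      calc δ ^ t ≤ δ ^ (1 : ℝ) := Real.rpow_le_rpow_of_exponent_ge hδ hδ1.le ht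
        _ = δ := Real.rpow_one δ
    obtain ⟨x, hx, hLx⟩ := hL.exists_step hd hs ht hst hκ hr hδ hδ1
      (by rw [hη, lt_div_iff₀ (by positivity)] at hδ3; linarith) X hsep hcard
      (fun x hx => (hX x hx).trans inter_subset_left)
    refine ⟨(x, δ ^ t), ⟨Real.rpow_pos_of_pos hδ t,
      ((hX x hx).trans inter_subset_left).trans hsub, hLx⟩, ?_, hX x hx⟩
    simp only
    linarith
  choose! step hstep1 hstep2 hstep3 using hstep
  set p : ℕ → ℝ × ℝ := fun k => Nat.rec (x₀, r₀) (fun k q => step k q) k with hp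
  have hpsucc : ∀ k, p (k + 1) = step k (p k) := fun k => rfl
  have hinv : ∀ k, 0 < (p k).2 ∧ Metric.closedBall (p k).1 (p k).2 ⊆ Metric.closedBall x₀ r₀ ∧
      LightOn z d s θ (p k).1 (p k).2 := by
    intro k
    induction k with
    | zero => exact ⟨hr₀, Subset.rfl, hbaseL⟩
    | succ k ih => rw [hpsucc]; exact hstep1 k _ ih
  have hsmall : ∀ k, (p k).2 ≤ r₀ * (1 / 2) ^ k := by
    intro k
    induction k with
    | zero => simp [hp]
    | succ k ih =>
      rw [hpsucc, pow_succ]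
      have := hstep2 k _ (hinv k)
      linarith
  obtain ⟨x, hx⟩ := IsCompact.nonempty_iInter_of_sequence_nonempty_isCompact_isClosed
    (fun k => Metric.closedBall (p k).1 (p k).2)
    (fun k => by
      simp only [hpsucc]
      exact (hstep3 k _ (hinv k)).trans inter_subset_left)
    (fun k => ⟨(p k).1, Metric.mem_closedBall_self (hinv k).1.le⟩)
    (isCompact_closedBall _ _) (fun k => Metric.isClosed_closedBall)
  rw [mem_iInter] at hx
  have hxmem : x ∈ Metric.closedBall x₀ r₀ ∩ ⋂ k, W k := by
    refine ⟨hx 0, mem_iInter.2 fun k => ?_⟩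
    have := hx (k + 1)
    rw [hpsucc] at this
    exact (hstep3 k _ (hinv k) this).2
  obtain ⟨i, hi⟩ := mem_iUnion.1 (hV hxmem)
  have hdi : ∀ k, d i ≤ θ * (p k).2 := by
    intro k
    have := (hinv k).2.2 {i} (by simpa using ⟨x, hz i hi, hx k⟩)
    rw [Finset.sum_singleton] at this
    exact (Real.rpow_le_rpow_iff (hd i).le (mul_nonneg hθ.le (hinv k).1.le) hs).1 this
  have hlim : Tendsto (fun k : ℕ => θ * (r₀ * (1 / 2 : ℝ) ^ k)) atTop (nhds (θ * (r₀ * 0))) :=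
    ((tendsto_pow_atTop_nhds_zero_of_lt_one (by norm_num) (by norm_num)).const_mul r₀).const_mul θ
  have := ge_of_tendsto' hlim fun k => (hdi k).trans
    (mul_le_mul_of_nonneg_left (hsmall k) hθ.le)
  simp only [mul_zero] at this
  linarith [hd i]

/-- If near every point of a bounded set `E` a proportion at most `η` of a suitable ball is in
`E`, then `E` itself is small. -/
lemma exists_volume_le_of_local :
    ∃ N : ENNReal, N ≠ ⊤ ∧ ∀ (E : Set ℝ) (ρ : ℝ → ℝ) (y₀ r₀ R : ℝ) (η : ENNReal),
      (∀ y ∈ E, 0 < ρ y ∧ ρ y ≤ R) → E ⊆ Metric.closedBall y₀ r₀ →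
      (∀ y ∈ E, volume (E ∩ Metric.closedBall y (ρ y)) ≤ η * ENNReal.ofReal (2 * ρ y)) →
      volume E ≤ N * (η * ENNReal.ofReal (2 * (r₀ + R))) := by
  obtain ⟨N, τ, hτ, hN⟩ := HasBesicovitchCovering.no_satelliteConfig (α := ℝ)
  refine ⟨N, ENNReal.natCast_ne_top N, fun E ρ y₀ r₀ R η hρ hE hloc => ?_⟩
  let q : Besicovitch.BallPackage E ℝ :=
    { c := fun y => y
      r := fun y => ρ y
      rpos := fun y => (hρ y y.2).1
      r_bound := R
      r_le := fun y => (hρ y y.2).2 }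
  obtain ⟨s, hdisj, hcov⟩ := Besicovitch.exist_disjoint_covering_families hτ hN q
  have hcount : ∀ i, (s i).Countable := fun i =>
    (hdisj i).countable_of_nonempty_interior fun y _ =>
      ⟨q.c y, Metric.ball_subset_interior_closedBall (Metric.mem_ball_self (q.rpos y))⟩
  have hfam : ∀ i, volume (⋃ j ∈ s i, E ∩ Metric.closedBall (q.c j) (q.r j)) ≤
      η * ENNReal.ofReal (2 * (r₀ + R)) := by
    intro i
    calc volume (⋃ j ∈ s i, E ∩ Metric.closedBall (q.c j) (q.r j))
        ≤ ∑' j : s i, volume (E ∩ Metric.closedBall (q.c j) (q.r j)) :=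
          measure_biUnion_le _ (hcount i) _
      _ ≤ ∑' j : s i, η * volume (Metric.closedBall (q.c j) (q.r j)) := by
          refine ENNReal.tsum_le_tsum fun j => ?_
          rw [Real.volume_closedBall]
          exact hloc j.1 j.1.2
      _ = η * volume (⋃ j ∈ s i, Metric.closedBall (q.c j) (q.r j)) := by
          rw [ENNReal.tsum_mul_left, measure_biUnion (hcount i) (hdisj i)
            fun j _ => measurableSet_closedBall]
      _ ≤ η * ENNReal.ofReal (2 * (r₀ + R)) := by
          gcongr
          rw [← Real.volume_closedBall y₀]
          refine measure_mono (iUnion₂_subset fun j _ => Metric.closedBall_subset_closedBall' ?_)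
          have h1 : dist (j : ℝ) y₀ ≤ r₀ := hE j.2
          have h2 := (hρ j j.2).2
          calc q.r j + dist (q.c j) y₀ ≤ R + r₀ := add_le_add h2 h1
            _ ≤ _ := by linarith
  calc volume E ≤ volume (⋃ i, ⋃ j ∈ s i, E ∩ Metric.closedBall (q.c j) (q.r j)) := by
        refine measure_mono fun y hy => ?_
        have := hcov ⟨⟨y, hy⟩, rfl⟩
        simp only [mem_iUnion] at this ⊢
        obtain ⟨i, j, hj, hyj⟩ := this
        exact ⟨i, j, hj, hy, Metric.ball_subset_closedBall hyj⟩
    _ ≤ ∑ i, volume (⋃ j ∈ s i, E ∩ Metric.closedBall (q.c j) (q.r j)) :=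
        measure_iUnion_fintype_le _ _
    _ ≤ ∑ _i : Fin N, η * ENNReal.ofReal (2 * (r₀ + R)) := Finset.sum_le_sum fun i _ => hfam i
    _ = N * (η * ENNReal.ofReal (2 * (r₀ + R))) := by simp

/-- The point `x` is marked by a flag `F` in `S` on which `φ` is between `ε` and `1`, while `φ`
is at least `1` on everything else comparable to `F`. -/
def IsMarked {P : Type*} [PartialOrder P] (φ : P → ℝ → ℝ) (ε : ℝ) (S : Set P) (x : ℝ) : Prop :=
  ∃ F : Finset P, ↑F ⊆ S ∧ IsChain (· ≤ ·) (F : Set P) ∧ (∀ s ∈ F, ε ≤ φ s x ∧ φ s x < 1) ∧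
    ∀ t ∈ S, t ∉ F → (∀ s ∈ F, s ≤ t ∨ t ≤ s) → 1 ≤ φ t x

/-- Quantitative nondivergence in the abstract setting of partially ordered sets
(Kleinbock and Margulis). -/
theorem exists_volume_not_isMarked_le (P : Type*) [PartialOrder P] (m : ℕ) :
    ∃ C : ENNReal, C ≠ ⊤ ∧ ∀ (φ : P → ℝ → ℝ) (ε : ℝ) (η : ENNReal) (U : Set ℝ),
      (∀ s, ∀ x ∈ U, ContinuousAt (φ s) x) →
      (∀ s y r, 0 < r → Metric.closedBall y r ⊆ U → (∃ z ∈ Metric.closedBall y r, 1 ≤ φ s z) →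
        volume {x ∈ Metric.closedBall y r | φ s x < ε} ≤ η * ENNReal.ofReal (2 * r)) →
      ∀ (S : Set P), (∀ F : Finset P, ↑F ⊆ S → IsChain (· ≤ ·) (F : Set P) → F.card ≤ m) →
      ∀ y₀ r₀, 0 < r₀ → Metric.closedBall y₀ (5 ^ m * r₀) ⊆ U →
        (∀ s ∈ S, ∃ z ∈ Metric.closedBall y₀ r₀, 1 ≤ φ s z) →
        volume {x ∈ Metric.closedBall y₀ r₀ | ¬ IsMarked φ ε S x} ≤
          C * η * ENNReal.ofReal (2 * r₀) := by
  classical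
  induction m with
  | zero =>
    refine ⟨0, by simp, fun φ ε η U _ _ S hS y₀ r₀ _ _ _ => ?_⟩
    have hSe : ∀ s, s ∉ S := fun s hs => by
      have := hS {s} (by simpa using hs) (by simp)
      simp at this
    have : {x ∈ Metric.closedBall y₀ r₀ | ¬ IsMarked φ ε S x} = ∅ := by
      ext x
      simp only [mem_ofPred_eq, mem_empty_iff_false, iff_false, not_and, not_not]
      exact fun _ => ⟨∅, by simp, by simp, by simp, fun t ht => absurd ht (hSe t)⟩
    rw [this]; simp
  | succ m ih =>
    obtain ⟨C, hC, hCm⟩ := ih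
    obtain ⟨N, hN, hNcov⟩ := exists_volume_le_of_local
    refine ⟨N * (6 * (1 + C)), by finiteness, fun φ ε η U hcont hgood S hS y₀ r₀ hr₀ hU hsup => ?_⟩
    set E : Set ℝ := {x ∈ Metric.closedBall y₀ r₀ | ¬ IsMarked φ ε S x} with hEdef
    have hpow : (1 : ℝ) ≤ 5 ^ m := one_le_pow₀ (by norm_num)
    have hballU : Metric.closedBall y₀ r₀ ⊆ U :=
      (Metric.closedBall_subset_closedBall (by rw [pow_succ]; nlinarith)).trans hU
    have hrad : ∀ y ∈ E, ∃ ρ, 0 < ρ ∧ ρ ≤ 2 * r₀ ∧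
        (∃ s ∈ S, ∀ x ∈ Metric.closedBall y ρ, φ s x < 1) ∧
        ∀ s ∈ S, ∃ z ∈ Metric.closedBall y (2 * ρ), 1 ≤ φ s z := by
      intro y hy
      set A : Set ℝ := {r | 0 < r ∧ ∃ s ∈ S, ∀ x ∈ Metric.closedBall y r, φ s x < 1} with hA
      have hbdd : ∀ r ∈ A, r ≤ 2 * r₀ := by
        rintro r ⟨-, s, hs, hlt⟩
        by_contra! hgt
        obtain ⟨z, hz, h1⟩ := hsup s hs
        have hyb := hy.1
        rw [Metric.mem_closedBall] at hz hyb
        have : dist z y ≤ r := by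
          calc dist z y ≤ dist z y₀ + dist y y₀ := dist_triangle_right z y y₀
            _ ≤ r := by linarith
        exact absurd (hlt z this) (not_lt.2 h1)
      have hne : A.Nonempty := by
        have hex : ∃ s ∈ S, φ s y < 1 := by
          by_contra! hcon
          exact hy.2 ⟨∅, by simp, by simp, by simp, fun t ht _ _ => hcon t ht⟩
        obtain ⟨s, hs, hlt⟩ := hex
        have := (hcont s y (hballU hy.1)).eventually_lt_const hlt
        obtain ⟨r, hr, hball⟩ := Metric.nhds_basis_closedBall.mem_iff.1 this
        exact ⟨r, hr, s, hs, hball⟩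
      have hApos : 0 < sSup A := by
        obtain ⟨r, hr⟩ := hne
        exact hr.1.trans_le (le_csSup ⟨_, hbdd⟩ hr)
      obtain ⟨ρ, hρ, hρgt⟩ := exists_lt_of_lt_csSup hne (half_lt_self hApos)
      refine ⟨ρ, hρ.1, hbdd ρ hρ, hρ.2, fun s hs => ?_⟩
      by_contra! hcon
      have : 2 * ρ ∈ A := ⟨by linarith [hρ.1], s, hs, hcon⟩
      have := le_csSup ⟨_, hbdd⟩ this
      linarith
    choose! ρ hρ0 hρle hρin hρout using hrad
    have hloc : ∀ y ∈ E, volume (E ∩ Metric.closedBall y (ρ y)) ≤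
        (2 * (1 + C) * η) * ENNReal.ofReal (2 * ρ y) := by
      intro y hy
      obtain ⟨s, hs, hlt⟩ := hρin y hy
      have hyb : dist y y₀ ≤ r₀ := hy.1
      have hρpos := hρ0 y hy
      have hρle' := hρle y hy
      have hsub5 : Metric.closedBall y (5 ^ m * (2 * ρ y)) ⊆ U := by
        refine (Metric.closedBall_subset_closedBall' ?_).trans hU
        rw [pow_succ]
        nlinarith
      have hsub2 : Metric.closedBall y (2 * ρ y) ⊆ U :=
        (Metric.closedBall_subset_closedBall (by nlinarith)).trans hsub5
      set S' : Set P := {t ∈ S | t ≠ s ∧ (s ≤ t ∨ t ≤ s)} with hS'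
      have hchain : ∀ F : Finset P, ↑F ⊆ S' → IsChain (· ≤ ·) (F : Set P) → F.card ≤ m := by
        intro F hF hFc
        have hsF : s ∉ F := fun h => (hF h).2.1 rfl
        have := hS (insert s F) (by
          intro t ht
          rcases Finset.mem_insert.1 (Finset.mem_coe.1 ht) with rfl | h
          · exact hs
          · exact (hF h).1) (by
          rw [Finset.coe_insert]
          exact hFc.insert fun t ht _ => (hF ht).2.2)
        rw [Finset.card_insert_of_notMem hsF] at this
        omega
      have h1 := hCm φ ε η U hcont hgood S' hchain y (2 * ρ y) (by linarith) hsub5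
        (fun t ht => hρout y hy t ht.1)
      have h2 := hgood s y (2 * ρ y) (by linarith) hsub2 (hρout y hy s hs)
      have hsubset : E ∩ Metric.closedBall y (ρ y) ⊆
          {x ∈ Metric.closedBall y (2 * ρ y) | φ s x < ε} ∪
            {x ∈ Metric.closedBall y (2 * ρ y) | ¬ IsMarked φ ε S' x} := by
        rintro x ⟨hxE, hxy⟩
        have hx2 : x ∈ Metric.closedBall y (2 * ρ y) :=
          Metric.closedBall_subset_closedBall (by linarith) hxy
        by_contra hcon
        simp only [mem_union, mem_ofPred_eq, hx2, true_and, not_or, not_lt, not_not] at hcon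
        obtain ⟨hε, F, hF, hFc, hFφ, hFt⟩ := hcon
        refine hxE.2 ⟨insert s F, ?_, ?_, ?_, ?_⟩
        · intro t ht
          rcases Finset.mem_insert.1 (Finset.mem_coe.1 ht) with rfl | h
          · exact hs
          · exact (hF h).1
        · rw [Finset.coe_insert]
          exact hFc.insert fun t ht _ => (hF ht).2.2
        · intro t ht
          rcases Finset.mem_insert.1 ht with rfl | h
          · exact ⟨hε, hlt x hxy⟩
          · exact hFφ t h
        · intro t ht htF hcomp
          rw [Finset.mem_insert, not_or] at htF
          exact hFt t ⟨ht, htF.1, hcomp s (Finset.mem_insert_self _ _)⟩ htF.2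
            fun s' hs' => hcomp s' (Finset.mem_insert_of_mem hs')
      calc volume (E ∩ Metric.closedBall y (ρ y))
          ≤ η * ENNReal.ofReal (2 * (2 * ρ y)) + C * η * ENNReal.ofReal (2 * (2 * ρ y)) :=
            (measure_mono hsubset).trans ((measure_union_le _ _).trans (add_le_add h2 h1))
        _ = (2 * (1 + C) * η) * ENNReal.ofReal (2 * ρ y) := by
            rw [ENNReal.ofReal_mul (p := 2) (q := 2 * ρ y) (by norm_num)]
            simp only [ENNReal.ofReal_ofNat]
            ring
    have := hNcov E ρ y₀ r₀ (2 * r₀) (2 * (1 + C) * η) (fun y hy => ⟨hρ0 y hy, hρle y hy⟩)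
      (fun y hy => hy.1) hloc
    refine this.trans (le_of_eq ?_)
    have h3 : 2 * (r₀ + 2 * r₀) = 3 * (2 * r₀) := by ring
    rw [h3, ENNReal.ofReal_mul (p := 3) (by norm_num)]
    simp only [ENNReal.ofReal_ofNat]
    ring

/-- If `g 0` is small at `2 ^ j` separated points, then its `j`-th derivative is small
somewhere. -/
lemma exists_abs_iterated_le {U : Set ℝ} (hU : U.OrdConnected) (j : ℕ) {sep : ℝ} (hsep : 0 < sep)
    (g : ℕ → ℝ → ℝ) (hg : ∀ k < j, ∀ x ∈ U, HasDerivAt (g k) (g (k + 1) x) x) (ε : ℝ)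
    (x : ℕ → ℝ) (hx : ∀ i < 2 ^ j, x i ∈ U) (hgap : ∀ i, i + 1 < 2 ^ j → x i + sep ≤ x (i + 1))
    (hε : ∀ i < 2 ^ j, |g 0 (x i)| ≤ ε) :
    ∃ ξ ∈ U, |g j ξ| ≤ (2 / sep) ^ j * ε := by
  induction j generalizing g ε x with
  | zero => exact ⟨x 0, hx 0 (by simp), by simpa using hε 0 (by simp)⟩
  | succ j ih =>
    have hpow : 2 ^ (j + 1) = 2 * 2 ^ j := pow_succ' 2 j
    have hex : ∀ i, i < 2 ^ j → ∃ ξ ∈ Ioo (x (2 * i)) (x (2 * i + 1)),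
        |g 1 ξ| ≤ 2 / sep * ε := by
      intro i hi
      have h1 := hx (2 * i) (by omega)
      have h2 := hx (2 * i + 1) (by omega)
      have hlt := hgap (2 * i) (by omega)
      have hsub : Icc (x (2 * i)) (x (2 * i + 1)) ⊆ U := hU.out h1 h2
      obtain ⟨ξ, hξ, heq⟩ := exists_hasDerivAt_eq_slope (g 0) (g 1)
        (by linarith : x (2 * i) < x (2 * i + 1))
        (fun y hy => (hg 0 (by omega) y (hsub hy)).continuousAt.continuousWithinAt)
        (fun y hy => hg 0 (by omega) y (hsub (Ioo_subset_Icc_self hy)))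
      refine ⟨ξ, hξ, ?_⟩
      have hpos : 0 < x (2 * i + 1) - x (2 * i) := by linarith
      have e1 := hε (2 * i) (by omega)
      have e2 := hε (2 * i + 1) (by omega)
      have hε0 : 0 ≤ ε := (abs_nonneg _).trans e1
      rw [heq, abs_div, abs_of_pos hpos]
      calc |g 0 (x (2 * i + 1)) - g 0 (x (2 * i))| / (x (2 * i + 1) - x (2 * i))
          ≤ (ε + ε) / sep := by
            gcongr
            · exact (abs_sub _ _).trans (add_le_add e2 e1)
            · linarith
        _ = 2 / sep * ε := by ring
    choose! ξ hξ hgξ using hex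
    obtain ⟨w, hw, hgw⟩ := ih (fun k => g (k + 1)) (fun k hk => hg (k + 1) (by omega))
      (2 / sep * ε) ξ
      (fun i hi => hU.out (hx (2 * i) (by omega)) (hx (2 * i + 1) (by omega))
        (Ioo_subset_Icc_self (hξ i hi)))
      (fun i hi => by
        have h1 := (hξ i (by omega)).2
        have h2 := hgap (2 * i + 1) (by omega)
        have h3 := (hξ (i + 1) hi).1
        have h4 : 2 * (i + 1) = 2 * i + 1 + 1 := by ring
        rw [h4] at h3
        linarith)
      hgξ
    exact ⟨w, hw, hgw.trans (le_of_eq (by ring))⟩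

/-- The functions `d i j` (the `j`-th derivative of the `i`-th coordinate of a curve) are
uniformly nondegenerate on `U`. -/
structure NondegenerateOn {n : ℕ} (d : Fin n → ℕ → ℝ → ℝ) (U : Set ℝ) (K : ℝ) : Prop where
  hasDerivAt : ∀ i, ∀ j < n, ∀ x ∈ U, HasDerivAt (d i j) (d i (j + 1) x) x
  bound : ∀ i, ∀ x ∈ U, |d i n x| ≤ K
  inverse : ∀ ξ : Fin n → ℝ, (∀ j, ξ j ∈ U) → ∀ (c : Fin n → ℝ) (η : ℝ),
    (∀ j : Fin n, |∑ i, c i * d i (j + 1) (ξ j)| ≤ η) → ∀ i, |c i| ≤ K * η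

/-- A function `p + ∑ c i * f i` small at `2 ^ n` separated points of an interval has small
coefficients and is small on the interval. -/
lemma NondegenerateOn.exists_remez {n : ℕ} (hn : 1 ≤ n) {d : Fin n → ℕ → ℝ → ℝ} {U : Set ℝ}
    {K : ℝ} (hd : NondegenerateOn d U K) :
    ∃ C : ℝ, 0 < C ∧ ∀ y r, 0 < r → Metric.closedBall y r ⊆ U → ∀ sep, 0 < sep → sep ≤ 1 →
      ∀ x : ℕ → ℝ, (∀ i < 2 ^ n, x i ∈ Metric.closedBall y r) →
      (∀ i, i + 1 < 2 ^ n → x i + sep ≤ x (i + 1)) →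
      ∀ (p : ℝ) (c : Fin n → ℝ) (ε : ℝ), (∀ i < 2 ^ n, |p + ∑ k, c k * d k 0 (x i)| ≤ ε) →
        (∀ k, |c k| ≤ C * ε / sep ^ n) ∧
          ∀ z ∈ Metric.closedBall y r, |p + ∑ k, c k * d k 0 z| ≤ C * ε * (2 * r / sep) ^ n := by
  set K' : ℝ := max K 1 with hK'
  have hK'1 : 1 ≤ K' := le_max_right _ _
  have hK0 : 0 ≤ K' := by linarith
  set M : ℝ := n * K' * (K' * 2 ^ n) with hM
  have hM0 : 0 ≤ M := by positivity
  refine ⟨K' * 2 ^ n + (M + n * 2 ^ n), by positivity, ?_⟩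
  intro y r hr hsub sep hsep hsep1 x hx hgap p c ε hε
  have h2n : 2 ≤ 2 ^ n := by
    calc 2 = 2 ^ 1 := rfl
      _ ≤ 2 ^ n := Nat.pow_le_pow_right (by norm_num) hn
  have hε0 : 0 ≤ ε := (abs_nonneg _).trans (hε 0 (by omega))
  have hsepr : sep ≤ 2 * r := by
    have h0 := hx 0 (by omega)
    have h1 := hx 1 (by omega)
    have h2 := hgap 0 (by omega)
    rw [Real.closedBall_eq_Icc] at h0 h1
    simp only [zero_add] at h2
    linarith [h0.1, h1.2]
  set g : ℕ → ℝ → ℝ := fun j z => (if j = 0 then p else 0) + ∑ k, c k * d k j z with hgdef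
  have hg : ∀ j < n, ∀ z ∈ Metric.closedBall y r, HasDerivAt (g j) (g (j + 1) z) z := by
    intro j hj z hz
    have h1 : HasDerivAt (fun w => ∑ k, c k * d k j w) (∑ k, c k * d k (j + 1) z) z := by
      exact HasDerivAt.fun_sum fun k _ => (hd.hasDerivAt k j hj z (hsub hz)).const_mul (c k)
    simpa [hgdef] using h1.const_add (if j = 0 then p else 0)
  have hord : (Metric.closedBall y r).OrdConnected := by
    rw [Real.closedBall_eq_Icc]; exact ordConnected_Icc
  have hpts : ∀ j ≤ n, ∃ ξ ∈ Metric.closedBall y r, |g j ξ| ≤ (2 / sep) ^ j * ε := by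
    intro j hj
    have hle : 2 ^ j ≤ 2 ^ n := Nat.pow_le_pow_right (by norm_num) hj
    exact exists_abs_iterated_le hord j hsep g (fun k hk => hg k (hk.trans_le hj)) ε x
      (fun i hi => hx i (hi.trans_le hle)) (fun i hi => hgap i (hi.trans_le hle))
      fun i hi => by simpa [hgdef] using hε i (hi.trans_le hle)
  choose! ξ hξ hgξ using hpts
  have hc : ∀ k, |c k| ≤ K' * (2 ^ n * ε / sep ^ n) := by
    intro k
    have h := hd.inverse (fun j => ξ (j + 1)) (fun j => hsub (hξ _ (by omega))) c
      (2 ^ n * ε / sep ^ n) (fun j => by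
        have h1 := hgξ (j + 1) (by omega)
        simp only [hgdef, Nat.add_eq_zero_iff, one_ne_zero, and_false, if_false, zero_add] at h1
        refine h1.trans ?_
        have h2 : (2 / sep) ^ ((j : ℕ) + 1) ≤ (2 / sep) ^ n :=
          pow_le_pow_right₀ (by rw [le_div_iff₀ hsep]; linarith) (by omega)
        calc (2 / sep) ^ ((j : ℕ) + 1) * ε ≤ (2 / sep) ^ n * ε := by gcongr
          _ = _ := by rw [div_pow]; ring) k
    refine h.trans ?_
    gcongr
    exact le_max_left _ _
  have hdesc : ∀ i ≤ n, ∀ z ∈ Metric.closedBall y r,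
      |g (n - i) z| ≤ (M + i * 2 ^ n) * ε * (2 * r) ^ i / sep ^ n := by
    intro i
    induction i with
    | zero =>
      intro _ z hz
      have hn0 : n ≠ 0 := by omega
      simp only [hgdef, Nat.sub_zero, if_neg hn0, zero_add]
      calc |∑ k, c k * d k n z| ≤ ∑ k, |c k * d k n z| := Finset.abs_sum_le_sum_abs _ _
        _ ≤ ∑ _k : Fin n, K' * (2 ^ n * ε / sep ^ n) * K' := by
            refine Finset.sum_le_sum fun k _ => ?_
            rw [abs_mul]
            exact mul_le_mul (hc k) ((hd.bound k z (hsub hz)).trans (le_max_left _ _))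
              (abs_nonneg _) (by positivity)
        _ = (M + (0 : ℕ) * 2 ^ n) * ε * (2 * r) ^ 0 / sep ^ n := by
            simp [hM]; ring
    | succ i ih =>
      intro hi z hz
      have hb := ih (by omega)
      have heq : n - i = n - (i + 1) + 1 := by omega
      have hlip : |g (n - (i + 1)) z - g (n - (i + 1)) (ξ (n - (i + 1)))| ≤
          (M + i * 2 ^ n) * ε * (2 * r) ^ i / sep ^ n *
            |z - ξ (n - (i + 1))| := by
        have := (convex_closedBall y r).norm_image_sub_le_of_norm_hasDerivWithin_le
          (f := g (n - (i + 1))) (f' := g (n - i))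
          (C := (M + i * 2 ^ n) * ε * (2 * r) ^ i / sep ^ n)
          (fun w hw => by
            rw [heq]; exact (hg _ (by omega) w hw).hasDerivWithinAt)
          (fun w hw => hb w hw) (hξ (n - (i + 1)) (by omega)) hz
        simpa [Real.norm_eq_abs] using this
      have hdist : |z - ξ (n - (i + 1))| ≤ 2 * r := by
        have h1 := hξ (n - (i + 1)) (by omega)
        rw [Real.closedBall_eq_Icc] at h1 hz
        rw [abs_le]
        constructor <;> linarith [h1.1, h1.2, hz.1, hz.2]
      have h0 := hgξ (n - (i + 1)) (by omega)
      have h0' : (2 / sep) ^ (n - (i + 1)) * ε ≤ 2 ^ n * ε * (2 * r) ^ (i + 1) / sep ^ n := by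
        have hsplit : sep ^ n = sep ^ (n - (i + 1)) * sep ^ (i + 1) := by
          rw [← pow_add]; congr 1; omega
        rw [hsplit, div_pow, div_mul_eq_mul_div, div_le_div_iff₀ (by positivity) (by positivity)]
        have h1 : (2 : ℝ) ^ (n - (i + 1)) ≤ 2 ^ n :=
          pow_le_pow_right₀ (by norm_num) (by omega)
        have h2 : sep ^ (i + 1) ≤ (2 * r) ^ (i + 1) := pow_le_pow_left₀ hsep.le hsepr _
        calc 2 ^ (n - (i + 1)) * ε * (sep ^ (n - (i + 1)) * sep ^ (i + 1))
            ≤ 2 ^ n * ε * (sep ^ (n - (i + 1)) * (2 * r) ^ (i + 1)) := by gcongr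
          _ = _ := by ring
      have htri : |g (n - (i + 1)) z| ≤ |g (n - (i + 1)) z - g (n - (i + 1)) (ξ (n - (i + 1)))| +
          |g (n - (i + 1)) (ξ (n - (i + 1)))| := by
        have := abs_add_le (g (n - (i + 1)) z - g (n - (i + 1)) (ξ (n - (i + 1))))
          (g (n - (i + 1)) (ξ (n - (i + 1))))
        simpa using this
      calc |g (n - (i + 1)) z|
          ≤ (M + i * 2 ^ n) * ε * (2 * r) ^ i / sep ^ n * (2 * r) +
            2 ^ n * ε * (2 * r) ^ (i + 1) / sep ^ n := by
            refine htri.trans (add_le_add (hlip.trans ?_) (h0.trans h0'))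
            gcongr
        _ = _ := by push_cast; rw [pow_succ]; ring
  constructor
  · intro k
    refine (hc k).trans ?_
    rw [← mul_div_assoc, ← mul_assoc]
    have hle : K' * 2 ^ n ≤ K' * 2 ^ n + (M + n * 2 ^ n) := le_add_of_nonneg_right (by positivity)
    exact div_le_div_of_nonneg_right (mul_le_mul_of_nonneg_right hle hε0) (by positivity)
  · intro z hz
    have := hdesc n le_rfl z hz
    simp only [hgdef, Nat.sub_self, if_true] at this
    refine this.trans ?_
    rw [div_pow, ← mul_div_assoc]
    have hle : M + n * 2 ^ n ≤ K' * 2 ^ n + (M + n * 2 ^ n) := le_add_of_nonneg_left (by positivity)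
    exact div_le_div_of_nonneg_right (mul_le_mul_of_nonneg_right
      (mul_le_mul_of_nonneg_right hle hε0) (by positivity)) (by positivity)

/-- The largest absolute value of a maximal minor of a matrix. -/
noncomputable def pluckerNorm {j N : ℕ} (W : Matrix (Fin j) (Fin N) ℝ) : ℝ :=
  ‖fun I : Fin j → Fin N => (W.submatrix id I).det‖

lemma abs_minor_le_pluckerNorm {j N : ℕ} (W : Matrix (Fin j) (Fin N) ℝ) (I : Fin j → Fin N) :
    |(W.submatrix id I).det| ≤ pluckerNorm W :=
  norm_le_pi_norm (fun I : Fin j → Fin N => (W.submatrix id I).det) I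

lemma pluckerNorm_nonneg {j N : ℕ} (W : Matrix (Fin j) (Fin N) ℝ) : 0 ≤ pluckerNorm W :=
  norm_nonneg _

lemma pluckerNorm_mul {j N : ℕ} (A : Matrix (Fin j) (Fin j) ℝ) (W : Matrix (Fin j) (Fin N) ℝ) :
    pluckerNorm (A * W) = |A.det| * pluckerNorm W := by
  rw [pluckerNorm, pluckerNorm, ← Real.norm_eq_abs, ← norm_smul]
  congr 1
  ext I
  rw [Matrix.submatrix_mul A W id id I Function.bijective_id, Matrix.submatrix_id_id,
    Matrix.det_mul]
  rfl

lemma pluckerNorm_of_isEmpty {N : ℕ} (W : Matrix (Fin 0) (Fin N) ℝ) : pluckerNorm W = 1 := by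
  have : (fun I : Fin 0 → Fin N => (W.submatrix id I).det) = fun _ => 1 := by
    ext I; exact Matrix.det_isEmpty
  rw [pluckerNorm, this, pi_norm_const]
  simp

lemma pluckerNorm_vecCons_le {j N : ℕ} (u : Fin N → ℝ) (W : Matrix (Fin j) (Fin N) ℝ) :
    pluckerNorm (Matrix.of (Matrix.vecCons u W)) ≤ (j + 1) * ‖u‖ * pluckerNorm W := by
  refine (pi_norm_le_iff_of_nonneg
    (mul_nonneg (by positivity) (pluckerNorm_nonneg W))).2 fun I => ?_
  rw [Matrix.det_succ_row_zero]
  refine (norm_sum_le _ _).trans ?_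
  calc _ ≤ ∑ _k : Fin (j + 1), ‖u‖ * pluckerNorm W := by
        refine Finset.sum_le_sum fun k _ => ?_
        rw [norm_mul, norm_mul, norm_pow, norm_neg, norm_one, one_pow, one_mul]
        refine mul_le_mul (norm_le_pi_norm u (I k)) ?_ (norm_nonneg _) (norm_nonneg _)
        exact abs_minor_le_pluckerNorm W (I ∘ k.succAbove)
    _ = _ := by simp; ring

/-- A matrix with linearly independent rows has a nonzero maximal minor. -/
lemma exists_minor_ne_zero {K : Type*} [Field K] {j N : ℕ} (W : Matrix (Fin j) (Fin N) K)
    (hW : LinearIndependent K W.row) : ∃ I : Fin j → Fin N, (W.submatrix id I).det ≠ 0 := by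
  obtain ⟨κ, a, ha, hspan, hli⟩ := exists_linearIndependent' K W.col
  have : Finite κ := Finite.of_injective a ha
  have := Fintype.ofFinite κ
  have hcard : Fintype.card κ = j := by
    rw [← finrank_span_eq_card hli, hspan, ← Matrix.rank_eq_finrank_span_cols, hW.rank_matrix,
      Fintype.card_fin]
  let e : Fin j ≃ κ := (finCongr hcard.symm).trans (Fintype.equivFin κ).symm
  refine ⟨a ∘ e, ?_⟩
  have h : LinearIndependent K (W.submatrix id (a ∘ e)).col := hli.comp e e.injective
  rw [Matrix.linearIndependent_cols_iff_isUnit, Matrix.isUnit_iff_isUnit_det] at h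
  exact h.ne_zero

/-- The rows of `v` form a basis of the rational subspace `V`. -/
structure IsIntBasis {N j : ℕ} (V : Submodule ℚ (Fin N → ℚ)) (v : Matrix (Fin j) (Fin N) ℤ) :
    Prop where
  linearIndependent : LinearIndependent ℚ (v.map (Int.cast : ℤ → ℚ)).row
  span_eq : Submodule.span ℚ (range (v.map (Int.cast : ℤ → ℚ)).row) = V

lemma IsIntBasis.finrank_eq {N j : ℕ} {V : Submodule ℚ (Fin N → ℚ)}
    {v : Matrix (Fin j) (Fin N) ℤ} (h : IsIntBasis V v) : Module.finrank ℚ V = j := by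
  rw [← h.span_eq, finrank_span_eq_card h.linearIndependent, Fintype.card_fin]

lemma IsIntBasis.exists_minor_ne_zero {N j : ℕ} {V : Submodule ℚ (Fin N → ℚ)}
    {v : Matrix (Fin j) (Fin N) ℤ} (h : IsIntBasis V v) :
    ∃ I : Fin j → Fin N, (v.submatrix id I).det ≠ 0 := by
  obtain ⟨I, hI⟩ := _root_.exists_minor_ne_zero _ h.linearIndependent
  refine ⟨I, fun h0 => hI ?_⟩
  have := (Int.castRingHom ℚ).map_det (v.submatrix id I)
  rw [h0, map_zero] at this
  exact this.symm

lemma IsIntBasis.vecCons {N j : ℕ} {V : Submodule ℚ (Fin N → ℚ)}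
    {v : Matrix (Fin j) (Fin N) ℤ} (h : IsIntBasis V v) (u : Fin N → ℤ)
    (hu : (fun k => (u k : ℚ)) ∉ V) :
    IsIntBasis (V ⊔ Submodule.span ℚ {fun k => (u k : ℚ)})
      (Matrix.of (Matrix.vecCons u v)) := by
  have hrow : ((Matrix.of (Matrix.vecCons u v)).map (Int.cast : ℤ → ℚ)).row =
      Fin.cons (fun k => (u k : ℚ)) (v.map (Int.cast : ℤ → ℚ)).row := by
    ext i k
    refine Fin.cases ?_ (fun i => ?_) i <;> rfl
  constructor
  · rw [hrow, linearIndependent_finCons]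
    exact ⟨h.linearIndependent, by rwa [h.span_eq]⟩
  · rw [hrow, Fin.range_cons, Submodule.span_insert, h.span_eq, sup_comm]

/-- A subspace with an integer basis has an integer basis with smallest minors. -/
lemma exists_isIntBasis_forall_le {N j : ℕ} {V : Submodule ℚ (Fin N → ℚ)}
    (hV : ∃ v : Matrix (Fin j) (Fin N) ℤ, IsIntBasis V v) :
    ∃ v : Matrix (Fin j) (Fin N) ℤ, IsIntBasis V v ∧
      ∀ (u : Matrix (Fin j) (Fin N) ℤ), IsIntBasis V u → ∀ {L : ℕ} (H : Matrix (Fin N) (Fin L) ℝ),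
        pluckerNorm (v.map (Int.cast : ℤ → ℝ) * H) ≤
          pluckerNorm (u.map (Int.cast : ℤ → ℝ) * H) := by
  let size : Matrix (Fin j) (Fin N) ℤ → ℕ := fun v =>
    ∑ I : Fin j → Fin N, ((v.submatrix id I).det).natAbs
  obtain ⟨v, hv, hmin⟩ := (measure size).wf.has_min {v | IsIntBasis V v} hV
  refine ⟨v, hv, fun u hu L H => ?_⟩
  have hle : size v ≤ size u := not_lt.1 (hmin u hu)
  have hmem : ∀ a, ∃ c : Fin j → ℚ,
      ∑ b, c b • (v.map (Int.cast : ℤ → ℚ)).row b = (u.map (Int.cast : ℤ → ℚ)).row a := by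
    intro a
    rw [← Submodule.mem_span_range_iff_exists_fun, hv.span_eq, ← hu.span_eq]
    exact Submodule.subset_span (mem_range_self a)
  choose A hA using hmem
  have hmul : u.map (Int.cast : ℤ → ℚ) = Matrix.of A * v.map (Int.cast : ℤ → ℚ) := by
    ext a k
    have := congrFun (hA a) k
    simp only [Finset.sum_apply, Pi.smul_apply, smul_eq_mul] at this
    rw [Matrix.mul_apply]
    exact this.symm
  have hdet : ∀ I : Fin j → Fin N, (((u.submatrix id I).det : ℤ) : ℚ) =
      (Matrix.of A).det * ((v.submatrix id I).det : ℤ) := by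
    intro I
    have h1 := (Int.castRingHom ℚ).map_det (u.submatrix id I)
    have h2 := (Int.castRingHom ℚ).map_det (v.submatrix id I)
    simp only [eq_intCast] at h1 h2
    rw [h1, h2, ← Matrix.det_mul]
    congr 1
    change (u.map (Int.cast : ℤ → ℚ)).submatrix id I =
      Matrix.of A * (v.map (Int.cast : ℤ → ℚ)).submatrix id I
    rw [hmul, Matrix.submatrix_mul _ _ id id I Function.bijective_id, Matrix.submatrix_id_id]
  have hsize : (size u : ℚ) = |(Matrix.of A).det| * size v := by
    simp only [size, Nat.cast_sum, Nat.cast_natAbs, Int.cast_abs, hdet, abs_mul, Finset.mul_sum]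
  have hpos : 0 < size v := by
    obtain ⟨I, hI⟩ := hv.exists_minor_ne_zero
    exact lt_of_lt_of_le (Int.natAbs_pos.2 hI)
      (Finset.single_le_sum (f := fun I : Fin j → Fin N => ((v.submatrix id I).det).natAbs)
        (fun _ _ => Nat.zero_le _) (Finset.mem_univ I))
  have hA1 : 1 ≤ |(Matrix.of A).det| := by
    have h1 : (size v : ℚ) ≤ size u := by exact_mod_cast hle
    have h2 : (0 : ℚ) < size v := by exact_mod_cast hpos
    rw [hsize] at h1
    exact le_of_mul_le_mul_right (by simpa using h1) h2
  have hmulR : u.map (Int.cast : ℤ → ℝ) =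
      (Matrix.of A).map (Rat.cast : ℚ → ℝ) * v.map (Int.cast : ℤ → ℝ) := by
    have := congrArg (fun X : Matrix (Fin j) (Fin N) ℚ => X.map (Rat.castHom ℝ)) hmul
    simp only [Matrix.map_mul, Matrix.map_map] at this
    convert this using 2 <;> ext <;> simp
  have hdetR : ((Matrix.of A).map (Rat.cast : ℚ → ℝ)).det = ((Matrix.of A).det : ℝ) := by
    simpa using ((Rat.castHom ℝ).map_det (Matrix.of A)).symm
  rw [hmulR, Matrix.mul_assoc, pluckerNorm_mul, hdetR]
  refine le_mul_of_one_le_left (pluckerNorm_nonneg _) ?_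
  exact_mod_cast hA1

open Classical in
/-- The size of a rational subspace `V` measured by the linear map given by `H`. -/
noncomputable def covol {N L : ℕ} (H : Matrix (Fin N) (Fin L) ℝ)
    (V : Submodule ℚ (Fin N → ℚ)) : ℝ :=
  if h : ∃ v : Matrix (Fin (Module.finrank ℚ V)) (Fin N) ℤ, IsIntBasis V v then
    pluckerNorm ((exists_isIntBasis_forall_le h).choose.map (Int.cast : ℤ → ℝ) * H)
  else 1

lemma IsIntBasis.exists_covol {N j : ℕ} {V : Submodule ℚ (Fin N → ℚ)}
    {w : Matrix (Fin j) (Fin N) ℤ} (hw : IsIntBasis V w) (L : ℕ) :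
    ∃ v : Matrix (Fin j) (Fin N) ℤ, IsIntBasis V v ∧
      (∀ H : Matrix (Fin N) (Fin L) ℝ,
        covol H V = pluckerNorm (v.map (Int.cast : ℤ → ℝ) * H)) ∧
      ∀ u : Matrix (Fin j) (Fin N) ℤ, IsIntBasis V u → ∀ H : Matrix (Fin N) (Fin L) ℝ,
        covol H V ≤ pluckerNorm (u.map (Int.cast : ℤ → ℝ) * H) := by
  obtain rfl := hw.finrank_eq
  have h : ∃ v : Matrix (Fin (Module.finrank ℚ V)) (Fin N) ℤ, IsIntBasis V v := ⟨w, hw⟩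
  have hspec := (exists_isIntBasis_forall_le h).choose_spec
  refine ⟨_, hspec.1, fun H => by rw [covol, dif_pos h], fun u hu H => ?_⟩
  rw [covol, dif_pos h]
  exact hspec.2 u hu H

/-- The nonzero rational subspaces having an integer basis. -/
def intSubspaces (N : ℕ) : Set (Submodule ℚ (Fin N → ℚ)) :=
  {V | V ≠ ⊥ ∧ ∃ (j : ℕ) (v : Matrix (Fin j) (Fin N) ℤ), IsIntBasis V v}

lemma card_le_of_isChain_intSubspaces {N : ℕ} (F : Finset (Submodule ℚ (Fin N → ℚ)))
    (hF : ↑F ⊆ intSubspaces N) (hc : IsChain (· ≤ ·) (F : Set (Submodule ℚ (Fin N → ℚ)))) :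
    F.card ≤ N := by
  have h := Finset.card_le_card_of_injOn (s := F) (t := Finset.Icc 1 N)
    (fun V => Module.finrank ℚ V)
    (fun V hV => by
      rw [Finset.coe_Icc]
      refine ⟨?_, (Submodule.finrank_le V).trans_eq (by simp)⟩
      exact Nat.one_le_iff_ne_zero.2 fun h0 => (hF hV).1 (Submodule.finrank_eq_zero.1 h0))
    (fun V hV W hW h => by
      rcases hc.total hV hW with hle | hle
      · exact Submodule.eq_of_le_of_finrank_eq hle h
      · exact (Submodule.eq_of_le_of_finrank_eq hle h.symm).symm)
  simpa using h

/-- At a marked point, no nonzero integer vector is short. -/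
lemma IsMarked.le_norm_vecMul {N : ℕ} {H : ℝ → Matrix (Fin N) (Fin N) ℝ} {ε x : ℝ}
    (hε1 : ε ≤ 1)
    (hx : IsMarked (fun V y => covol (H y) V) ε (intSubspaces N) x) (u : Fin N → ℤ) (hu : u ≠ 0) :
    ε ≤ N * ‖Matrix.vecMul (fun k => (u k : ℝ)) (H x)‖ := by
  classical
  obtain ⟨F, hFS, hchain, hF, hmax⟩ := hx
  set uq : Fin N → ℚ := fun k => (u k : ℚ) with huq
  have huq0 : uq ≠ 0 := by
    intro h
    apply hu
    ext k
    have := congrFun h k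
    simpa [huq] using this
  obtain ⟨V, hV⟩ := ((insert ⊥ F).filter fun V => uq ∉ V).exists_maximal
    ⟨⊥, by simpa using huq0⟩
  have hVmem := hV.1
  have hVmax := hV.2
  simp only [Finset.mem_filter, Finset.mem_insert] at hVmem hVmax
  have hVbasis : (∃ (j : ℕ) (v : Matrix (Fin j) (Fin N) ℤ), IsIntBasis V v ∧
      pluckerNorm (v.map (Int.cast : ℤ → ℝ) * H x) ≤ 1) := by
    rcases hVmem.1 with h | h
    · refine ⟨0, 0, ⟨linearIndependent_empty_type, ?_⟩, (pluckerNorm_of_isEmpty _).le⟩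
      rw [range_eq_empty, Submodule.span_empty, h]
    · obtain ⟨j, w, hw⟩ := (hFS h).2
      obtain ⟨v, hv, hveq, -⟩ := hw.exists_covol N
      exact ⟨j, v, hv, by rw [← hveq]; exact (hF V h).2.le⟩
  obtain ⟨j, v, hv, hv1⟩ := hVbasis
  set W := V ⊔ Submodule.span ℚ {uq} with hW
  have hWb : IsIntBasis W (Matrix.of (Matrix.vecCons u v)) := hv.vecCons u hVmem.2
  have huW : uq ∈ W := Submodule.mem_sup_right (Submodule.mem_span_singleton_self _)
  have hWS : W ∈ intSubspaces N := by
    refine ⟨fun h => huq0 ?_, _, _, hWb⟩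
    rw [h] at huW
    simpa using huW
  have hcomp : ∀ s ∈ F, s ≤ W ∨ W ≤ s := by
    intro s hs
    have htot : s ≤ V ∨ V ≤ s := by
      rcases hVmem.1 with h | h
      · exact Or.inr (h ▸ bot_le)
      · exact hchain.total hs h
    by_cases hus : uq ∈ s
    · right
      have hVs : V ≤ s := htot.resolve_left fun h => hVmem.2 (h hus)
      exact sup_le hVs ((Submodule.span_singleton_le_iff_mem _ _).2 hus)
    · left
      refine le_trans ?_ le_sup_left
      rcases htot with h | h
      · exact h
      · exact hVmax ⟨Or.inr hs, hus⟩ h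
  have hεW : ε ≤ covol (H x) W := by
    by_cases hWF : W ∈ F
    · exact (hF W hWF).1
    · exact hε1.trans (hmax W hWS hWF hcomp)
  obtain ⟨_, _, _, hWle⟩ := hWb.exists_covol N
  refine hεW.trans ((hWle _ hWb (H x)).trans ?_)
  have hmul : (Matrix.of (Matrix.vecCons u v)).map (Int.cast : ℤ → ℝ) * H x =
      Matrix.of (Matrix.vecCons (Matrix.vecMul (fun k => (u k : ℝ)) (H x))
        (v.map (Int.cast : ℤ → ℝ) * H x)) := by
    ext i k
    refine Fin.cases ?_ (fun i => ?_) i <;> rfl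
  rw [hmul]
  refine (pluckerNorm_vecCons_le _ _).trans ?_
  have hjN : ((j : ℝ) + 1) ≤ N := by
    have h1 := hWb.finrank_eq
    have h2 := Submodule.finrank_le W
    rw [h1] at h2
    have h3 : j + 1 ≤ N := by simpa using h2
    exact_mod_cast h3
  calc _ ≤ (N : ℝ) * ‖Matrix.vecMul (fun k => (u k : ℝ)) (H x)‖ * 1 := by
        gcongr
        exact pluckerNorm_nonneg _
    _ = _ := mul_one _

lemma continuousAt_covol {N L : ℕ} {H : ℝ → Matrix (Fin N) (Fin L) ℝ} {x : ℝ}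
    (hH : ContinuousAt H x) (V : Submodule ℚ (Fin N → ℚ)) :
    ContinuousAt (fun y => covol (H y) V) x := by
  by_cases h : ∃ v : Matrix (Fin (Module.finrank ℚ V)) (Fin N) ℤ, IsIntBasis V v
  · simp only [covol, dif_pos h, pluckerNorm]
    refine ContinuousAt.norm (continuousAt_pi.2 fun I => ?_)
    have h1 : Continuous fun M : Matrix (Fin N) (Fin L) ℝ =>
        (((exists_isIntBasis_forall_le h).choose.map (Int.cast : ℤ → ℝ) * M).submatrix id I).det := by
      fun_prop
    exact h1.continuousAt.comp hH
  · simp only [covol, dif_neg h]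
    exact continuousAt_const

lemma NondegenerateOn.exists_large {n : ℕ} (hn : 1 ≤ n) {d : Fin n → ℕ → ℝ → ℝ} {U : Set ℝ}
    {K : ℝ} (hd : NondegenerateOn d U K) {y r : ℝ} (hr : 0 < r)
    (hU : Metric.closedBall y r ⊆ U) :
    ∃ κ : ℝ, 0 < κ ∧ ∀ (p : ℝ) (c : Fin n → ℝ), (∃ k, 1 ≤ |c k|) →
      ∃ z ∈ Metric.closedBall y r, κ ≤ |p + ∑ k, c k * d k 0 z| := by
  obtain ⟨C, hC, h⟩ := hd.exists_remez hn
  set sep : ℝ := min 1 (2 * r / 2 ^ n) with hsep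
  have hsep0 : 0 < sep := lt_min one_pos (by positivity)
  refine ⟨sep ^ n / (2 * C), by positivity, fun p c ⟨k, hk⟩ => ?_⟩
  by_contra! hcon
  have hle := (h y r hr hU sep hsep0 (min_le_left _ _) (fun i => y - r + i * sep)
    (fun i hi => by
      rw [Real.closedBall_eq_Icc]
      have h1 : (i : ℝ) ≤ 2 ^ n := by exact_mod_cast hi.le
      have h2 : (i : ℝ) * sep ≤ 2 ^ n * (2 * r / 2 ^ n) :=
        mul_le_mul h1 (min_le_right _ _) hsep0.le (by positivity)
      rw [mul_div_cancel₀ _ (by positivity)] at h2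
      have h3 : 0 ≤ (i : ℝ) * sep := by positivity
      constructor <;> linarith)
    (fun i hi => by push_cast; linarith) p c (sep ^ n / (2 * C))
    (fun i hi => (hcon _ ?_).le)).1 k
  · have : C * (sep ^ n / (2 * C)) / sep ^ n = 1 / 2 := by field_simp
    linarith
  · rw [Real.closedBall_eq_Icc]
    have h1 : (i : ℝ) ≤ 2 ^ n := by exact_mod_cast hi.le
    have h2 : (i : ℝ) * sep ≤ 2 ^ n * (2 * r / 2 ^ n) :=
      mul_le_mul h1 (min_le_right _ _) hsep0.le (by positivity)
    rw [mul_div_cancel₀ _ (by positivity)] at h2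
    have h3 : 0 ≤ (i : ℝ) * sep := by positivity
    constructor <;> linarith

lemma NondegenerateOn.exists_good {n : ℕ} (hn : 1 ≤ n) {d : Fin n → ℕ → ℝ → ℝ} {U : Set ℝ}
    {K : ℝ} (hd : NondegenerateOn d U K) {x₀ : ℝ} (hU : U ⊆ Metric.closedBall x₀ (1 / 2))
    {η : ℝ} (hη : 0 < η) :
    ∃ ε : ℝ, 0 < ε ∧ ε ≤ 1 ∧ ∀ y r, 0 < r → Metric.closedBall y r ⊆ U →
      ∀ (p : ℝ) (c : Fin n → ℝ), (∃ z ∈ Metric.closedBall y r, 1 ≤ |p + ∑ k, c k * d k 0 z|) →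
        volume {x ∈ Metric.closedBall y r | |p + ∑ k, c k * d k 0 x| < ε} ≤
          ENNReal.ofReal η * ENNReal.ofReal (2 * r) := by
  obtain ⟨C, hC, h⟩ := hd.exists_remez hn
  set t : ℝ := min 1 (η / (2 * 2 ^ n)) with ht
  have ht0 : 0 < t := lt_min one_pos (by positivity)
  have hpow : 1 ≤ 2 ^ n := Nat.one_le_two_pow
  refine ⟨min 1 (t ^ n / (2 * C)), lt_min one_pos (by positivity), min_le_left _ _, ?_⟩
  rintro y r hr hyr p c ⟨z, hz, hz1⟩
  have hr1 : 2 * r ≤ 1 := by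
    have h1 : y + r ∈ Metric.closedBall y r := by rw [Real.closedBall_eq_Icc]; constructor <;> linarith
    have h2 : y - r ∈ Metric.closedBall y r := by rw [Real.closedBall_eq_Icc]; constructor <;> linarith
    have h1' := hU (hyr h1)
    have h2' := hU (hyr h2)
    rw [Real.closedBall_eq_Icc] at h1' h2'
    linarith [h1'.2, h2'.1]
  set ε := min 1 (t ^ n / (2 * C)) with hε
  set A := {x ∈ Metric.closedBall y r | |p + ∑ k, c k * d k 0 x| < ε} with hA
  have hbdd : BddBelow A := by
    refine ⟨y - r, fun x hx => ?_⟩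
    have := hx.1
    rw [Real.closedBall_eq_Icc] at this
    exact this.1
  have hsep0 : 0 < 2 * r * t := by positivity
  rcases exists_separated_or_volume_le (2 ^ n - 1) hsep0 A hbdd with ⟨x, hx, hgap⟩ | hvol
  · exfalso
    have := (h y r hr hyr (2 * r * t) hsep0
      (mul_le_one₀ hr1 ht0.le (min_le_left _ _)) x (fun i hi => (hx i (by omega)).1)
      (fun i hi => hgap i (by omega)) p c ε (fun i hi => (hx i (by omega)).2.le)).2 z hz
    have h2 : C * ε * (2 * r / (2 * r * t)) ^ n ≤ 1 / 2 := by
      have h3 : 2 * r / (2 * r * t) = 1 / t := by field_simp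
      rw [h3]
      calc C * ε * (1 / t) ^ n ≤ C * (t ^ n / (2 * C)) * (1 / t) ^ n := by
            gcongr
            exact min_le_right _ _
        _ = 1 / 2 := by rw [one_div_pow]; field_simp
    linarith
  · refine hvol.trans ?_
    rw [← ENNReal.ofReal_mul hη.le]
    refine ENNReal.ofReal_le_ofReal ?_
    have h1 : ((2 ^ n - 1 : ℕ) : ℝ) ≤ 2 ^ n := by
      have : (2 ^ n - 1 : ℕ) ≤ 2 ^ n := Nat.sub_le _ _
      exact_mod_cast this
    calc 2 * ((2 ^ n - 1 : ℕ) : ℝ) * (2 * r * t) ≤ 2 * 2 ^ n * (2 * r * (η / (2 * 2 ^ n))) := by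
          gcongr
          exact min_le_right _ _
      _ = η * (2 * r) := by field_simp

/-- The linear map sending an integer vector `v` to
`(Q ^ n * (v 0 + ∑ i, v (i + 1) * g i), v 1 / Q, …, v n / Q)`, acting on row vectors. -/
noncomputable def flowMatrix {n : ℕ} (Q : ℝ) (g : Fin n → ℝ) :
    Matrix (Fin (n + 1)) (Fin (n + 1)) ℝ :=
  Matrix.of fun k => Fin.cons (Q ^ n * (Fin.cons 1 g : Fin (n + 1) → ℝ) k)
    fun i => if k = i.succ then Q⁻¹ else 0

lemma vecMul_flowMatrix_zero {n : ℕ} (Q : ℝ) (g : Fin n → ℝ) (v : Fin (n + 1) → ℝ) :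
    Matrix.vecMul v (flowMatrix Q g) 0 = Q ^ n * (v 0 + ∑ i, g i * v i.succ) := by
  simp only [Matrix.vecMul, dotProduct, flowMatrix, Matrix.of_apply, Fin.cons_zero,
    Fin.sum_univ_succ, Fin.cons_succ, mul_add, Finset.mul_sum]
  congr 1
  · ring
  · exact Finset.sum_congr rfl fun i _ => by ring

lemma vecMul_flowMatrix_succ {n : ℕ} (Q : ℝ) (g : Fin n → ℝ) (v : Fin (n + 1) → ℝ) (i : Fin n) :
    Matrix.vecMul v (flowMatrix Q g) i.succ = Q⁻¹ * v i.succ := by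
  simp [Matrix.vecMul, dotProduct, flowMatrix, mul_comm]

lemma det_flowMatrix {n : ℕ} {Q : ℝ} (hQ : Q ≠ 0) (g : Fin n → ℝ) :
    (flowMatrix Q g).det = 1 := by
  rw [Matrix.det_of_isLowerTriangular]
  · simp [Fin.prod_univ_succ, flowMatrix, hQ]
  · intro i j hij
    have hlt : i < j := hij
    obtain ⟨k, rfl⟩ := Fin.exists_succ_eq.2 (Fin.ne_zero_of_lt hlt)
    simp [flowMatrix, hlt.ne]

lemma det_submatrix_mul_flowMatrix {n j : ℕ} (Q : ℝ) (W : Matrix (Fin j) (Fin (n + 1)) ℝ)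
    {I : Fin j → Fin (n + 1)} (hI : Function.Injective I) {b : Fin j} (hb : I b = 0)
    (g : Fin n → ℝ) :
    ((W * flowMatrix Q g).submatrix id I).det = Q ^ n * Q⁻¹ ^ (j - 1) *
      ((W.submatrix id I).det +
        ∑ i, (W.submatrix id (Function.update I b i.succ)).det * g i) := by
  set s : Fin j → ℝ := Function.update (fun _ => Q⁻¹) b (Q ^ n) with hs
  set col : Fin j → ℝ := fun a => W a 0 + ∑ i, g i * W a (Fin.succ i) with hcol
  have h1 : (W * flowMatrix Q g).submatrix id I =
      Matrix.of fun a k => s k * ((W.submatrix id I).updateCol b col) a k := by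
    ext a k
    change Matrix.vecMul (W a) (flowMatrix Q g) (I k) = s k * _
    by_cases hk : k = b
    · subst hk
      rw [hb, vecMul_flowMatrix_zero, Matrix.updateCol_self, hs, Function.update_self]
    · have hne : I k ≠ 0 := fun h => hk (hI (h.trans hb.symm))
      obtain ⟨i, hi⟩ := Fin.exists_succ_eq.2 hne
      rw [← hi, vecMul_flowMatrix_succ, Matrix.updateCol_ne hk, hs, Function.update_of_ne hk,
        Matrix.submatrix_apply, ← hi]
      rfl
  have h2 : ∏ k, s k = Q ^ n * Q⁻¹ ^ (j - 1) := by
    rw [hs, Finset.prod_update_of_mem (Finset.mem_univ b), Finset.prod_const,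
      Finset.card_sdiff_of_subset (by simp)]
    simp
  have h3 : ∀ k, ((W.submatrix id I).updateCol b (fun a => W a k)) =
      W.submatrix id (Function.update I b k) := by
    intro k
    ext a c
    by_cases hc : c = b
    · subst hc; simp
    · simp [Matrix.updateCol_ne hc, Function.update_of_ne hc]
  have hcol' : col = (fun a => W a 0) + ∑ i, g i • fun a => W a (Fin.succ i) := by
    ext a; simp [hcol]
  rw [h1, Matrix.det_mul_row, h2, ← Matrix.cramer_apply, hcol', map_add, map_sum]
  simp only [map_smul, Pi.add_apply, Finset.sum_apply, Pi.smul_apply, smul_eq_mul,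
    Matrix.cramer_apply, h3]
  congr 2
  · rw [← hb, Function.update_eq_self]
  · exact Finset.sum_congr rfl fun i _ => mul_comm _ _

lemma exists_det_submatrix_mul_flowMatrix {n j : ℕ} (Q : ℝ) (W : Matrix (Fin j) (Fin (n + 1)) ℝ)
    (I : Fin j → Fin (n + 1)) :
    ∃ (p : ℝ) (c : Fin n → ℝ), ∀ g : Fin n → ℝ,
      ((W * flowMatrix Q g).submatrix id I).det = p + ∑ i, c i * g i := by
  by_cases hI : Function.Injective I
  · by_cases hb : ∃ b, I b = 0
    · obtain ⟨b, hb⟩ := hb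
      refine ⟨Q ^ n * Q⁻¹ ^ (j - 1) * (W.submatrix id I).det, fun i => Q ^ n * Q⁻¹ ^ (j - 1) *
        (W.submatrix id (Function.update I b i.succ)).det, fun g => ?_⟩
      rw [det_submatrix_mul_flowMatrix Q W hI hb, mul_add, Finset.mul_sum]
      congr 1
      exact Finset.sum_congr rfl fun i _ => by ring
    · push Not at hb
      refine ⟨((W * flowMatrix Q 0).submatrix id I).det, 0, fun g => ?_⟩
      simp only [Pi.zero_apply, zero_mul, Finset.sum_const_zero, add_zero]
      congr 1
      ext a k
      obtain ⟨i, hi⟩ := Fin.exists_succ_eq.2 (hb k)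
      change Matrix.vecMul (W a) (flowMatrix Q g) (I k) =
        Matrix.vecMul (W a) (flowMatrix Q 0) (I k)
      rw [← hi, vecMul_flowMatrix_succ, vecMul_flowMatrix_succ]
  · simp only [Function.Injective] at hI
    push Not at hI
    obtain ⟨k, l, hkl, hne⟩ := hI
    exact ⟨0, 0, fun g => by
      simpa using Matrix.det_zero_of_column_eq hne fun a => by simp [hkl]⟩

lemma NondegenerateOn.exists_volume_covol_lt_le {n : ℕ} (hn : 1 ≤ n) {d : Fin n → ℕ → ℝ → ℝ}
    {U : Set ℝ} {K : ℝ} (hd : NondegenerateOn d U K) {x₀ : ℝ}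
    (hU : U ⊆ Metric.closedBall x₀ (1 / 2)) {η : ℝ} (hη : 0 < η) :
    ∃ ε : ℝ, 0 < ε ∧ ε ≤ 1 ∧ ∀ (Q : ℝ) (V : Submodule ℚ (Fin (n + 1) → ℚ)) (y r : ℝ), 0 < r →
      Metric.closedBall y r ⊆ U →
      (∃ z ∈ Metric.closedBall y r, 1 ≤ covol (flowMatrix Q fun i => d i 0 z) V) →
        volume {x ∈ Metric.closedBall y r | covol (flowMatrix Q fun i => d i 0 x) V < ε} ≤
          ENNReal.ofReal η * ENNReal.ofReal (2 * r) := by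
  obtain ⟨ε, hε, hε1, h⟩ := hd.exists_good hn hU hη
  refine ⟨ε, hε, hε1, ?_⟩
  rintro Q V y r hr hyr ⟨z, hz, hz1⟩
  by_cases hV : ∃ v : Matrix (Fin (Module.finrank ℚ V)) (Fin (n + 1)) ℤ, IsIntBasis V v
  · obtain ⟨w, hw⟩ := hV
    obtain ⟨v, -, hcovol, -⟩ := hw.exists_covol (n + 1)
    simp only [hcovol] at hz1 ⊢
    obtain ⟨I, hI⟩ : ∃ I, 1 ≤ |((v.map (Int.cast : ℤ → ℝ) *
        flowMatrix Q fun i => d i 0 z).submatrix id I).det| := by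
      by_contra! hcon
      exact absurd hz1 (not_le.2 ((pi_norm_lt_iff one_pos).2 hcon))
    obtain ⟨p, c, hpc⟩ :=
      exists_det_submatrix_mul_flowMatrix Q (v.map (Int.cast : ℤ → ℝ)) I
    rw [hpc] at hI
    refine (measure_mono fun x hx => ?_).trans (h y r hr hyr p c ⟨z, hz, hI⟩)
    refine ⟨hx.1, ?_⟩
    rw [← hpc fun i => d i 0 x]
    exact (abs_minor_le_pluckerNorm _ I).trans_lt hx.2
  · have hempty : {x ∈ Metric.closedBall y r |
        covol (flowMatrix Q fun i => d i 0 x) V < ε} = ∅ := by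
      ext x
      simp [covol, dif_neg hV, hε1]
    rw [hempty, measure_empty]
    exact zero_le

lemma NondegenerateOn.exists_one_le_covol {n : ℕ} (hn : 1 ≤ n) {d : Fin n → ℕ → ℝ → ℝ}
    {U : Set ℝ} {K : ℝ} (hd : NondegenerateOn d U K) {y r : ℝ} (hr : 0 < r)
    (hU : Metric.closedBall y r ⊆ U) :
    ∃ Q₀ : ℝ, 1 ≤ Q₀ ∧ ∀ Q, Q₀ ≤ Q → ∀ V ∈ intSubspaces (n + 1),
      ∃ z ∈ Metric.closedBall y r, 1 ≤ covol (flowMatrix Q fun i => d i 0 z) V := by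
  obtain ⟨κ, hκ, h⟩ := hd.exists_large hn hr hU
  refine ⟨max 1 κ⁻¹, le_max_left _ _, ?_⟩
  rintro Q hQ V ⟨hVbot, j, w, hw⟩
  have hQ1 : 1 ≤ Q := (le_max_left _ _).trans hQ
  have hQκ : 1 ≤ Q * κ := by
    rw [← inv_le_iff_one_le_mul₀ hκ]; exact (le_max_right _ _).trans hQ
  have hQ0 : 0 < Q := by linarith
  obtain ⟨v, hv, hcovol, -⟩ := hw.exists_covol (n + 1)
  have hj : 1 ≤ j := by
    rw [← hv.finrank_eq, Nat.one_le_iff_ne_zero]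
    exact fun h0 => hVbot (Submodule.finrank_eq_zero.1 h0)
  have hminor : ∀ I : Fin j → Fin (n + 1),
      ((v.map (Int.cast : ℤ → ℝ)).submatrix id I).det = (((v.submatrix id I).det : ℤ) : ℝ) := by
    intro I
    exact ((Int.castRingHom ℝ).map_det (v.submatrix id I)).symm
  have habs : ∀ k : ℤ, k ≠ 0 → (1 : ℝ) ≤ |(k : ℝ)| := by
    intro k hk
    exact_mod_cast Int.one_le_abs hk
  have hinj : ∀ I : Fin j → Fin (n + 1), (v.submatrix id I).det ≠ 0 → Function.Injective I := by
    intro I hI k l hkl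
    by_contra hne
    exact hI (Matrix.det_zero_of_column_eq hne fun a => by simp [hkl])
  have key : ∃ (I : Fin j → Fin (n + 1)) (b : Fin j), Function.Injective I ∧ I b = 0 ∧
      ((v.submatrix id I).det ≠ 0 ∨
        ∃ i : Fin n, (v.submatrix id (Function.update I b i.succ)).det ≠ 0) := by
    obtain ⟨I, hI⟩ := hv.exists_minor_ne_zero
    by_cases hb : ∃ b, I b = 0
    · obtain ⟨b, hb⟩ := hb
      exact ⟨I, b, hinj I hI, hb, Or.inl hI⟩
    · push Not at hb
      let b : Fin j := ⟨0, hj⟩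
      obtain ⟨i, hi⟩ := Fin.exists_succ_eq.2 (hb b)
      refine ⟨Function.update I b 0, b, ?_, Function.update_self .., Or.inr ⟨i, ?_⟩⟩
      · intro k l hkl
        by_cases hk : k = b <;> by_cases hl : l = b
        · rw [hk, hl]
        · rw [hk, Function.update_self, Function.update_of_ne hl] at hkl
          exact absurd hkl.symm (hb l)
        · rw [hl, Function.update_self, Function.update_of_ne hk] at hkl
          exact absurd hkl (hb k)
        · rw [Function.update_of_ne hl, Function.update_of_ne hk] at hkl
          exact hinj I hI hkl
      · rwa [Function.update_idem, hi, Function.update_eq_self]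
  obtain ⟨I, b, hIinj, hb, hne⟩ := key
  have hscale : ∀ k : ℕ, k + (j - 1) ≤ n → Q ^ k ≤ Q ^ n * Q⁻¹ ^ (j - 1) := by
    intro k hk
    rw [inv_pow, ← div_eq_mul_inv, le_div_iff₀ (by positivity), ← pow_add]
    exact pow_le_pow_right₀ hQ1 hk
  have hminor_le : ∀ z, |Q ^ n * Q⁻¹ ^ (j - 1) * ((((v.submatrix id I).det : ℤ) : ℝ) +
      ∑ i, (((v.submatrix id (Function.update I b i.succ)).det : ℤ) : ℝ) * d i 0 z)| ≤
        covol (flowMatrix Q fun i => d i 0 z) V := by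
    intro z
    rw [hcovol]
    refine le_trans (le_of_eq ?_) (abs_minor_le_pluckerNorm _ I)
    rw [det_submatrix_mul_flowMatrix Q _ hIinj hb]
    simp only [hminor]
  by_cases hc : ∃ i : Fin n, (v.submatrix id (Function.update I b i.succ)).det ≠ 0
  · obtain ⟨i, hi⟩ := hc
    obtain ⟨z, hz, hz1⟩ := h (((v.submatrix id I).det : ℤ) : ℝ)
      (fun i => (((v.submatrix id (Function.update I b i.succ)).det : ℤ) : ℝ)) ⟨i, habs _ hi⟩
    refine ⟨z, hz, le_trans ?_ (hminor_le z)⟩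
    have hjn : j ≤ n := by
      have hinj' := hinj _ hi
      have hne0 : ∀ k, Function.update I b i.succ k ≠ 0 := by
        intro k
        by_cases hk : k = b
        · rw [hk, Function.update_self]; exact Fin.succ_ne_zero i
        · rw [Function.update_of_ne hk, ← hb]
          exact fun h => hk (hIinj h)
      choose e he using fun k => Fin.exists_succ_eq.2 (hne0 k)
      have heinj : Function.Injective e := fun k l hkl => hinj' (by rw [← he, ← he, hkl])
      simpa using Fintype.card_le_of_injective e heinj
    rw [abs_mul, abs_of_nonneg (by positivity)]
    have h1 := hscale 1 (by omega)
    rw [pow_one] at h1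
    calc 1 ≤ Q * κ := hQκ
      _ ≤ _ := mul_le_mul h1 hz1 hκ.le (by positivity)
  · have hI : (v.submatrix id I).det ≠ 0 := hne.resolve_right hc
    push Not at hc
    refine ⟨y, Metric.mem_closedBall_self hr.le, le_trans ?_ (hminor_le y)⟩
    simp only [hc, Int.cast_zero, zero_mul, Finset.sum_const_zero, add_zero]
    have hjn : j ≤ n + 1 := by simpa using Fintype.card_le_of_injective I hIinj
    have h1 := hscale 0 (by omega)
    rw [pow_zero] at h1
    rw [abs_mul, abs_of_nonneg (by positivity)]
    exact one_le_mul_of_one_le_of_one_le h1 (habs _ hI)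

lemma continuousAt_flowMatrix {n : ℕ} {Q x : ℝ} {g : ℝ → Fin n → ℝ} (hg : ContinuousAt g x) :
    ContinuousAt (fun y => flowMatrix Q (g y)) x := by
  have : Continuous fun w : Fin n → ℝ => flowMatrix Q w := by
    refine continuous_pi fun k => continuous_pi fun i => ?_
    refine Fin.cases ?_ (fun i => ?_) i
    · refine Fin.cases ?_ (fun k => ?_) k
      · simp only [flowMatrix, Matrix.of_apply, Fin.cons_zero]
        fun_prop
      · simp only [flowMatrix, Matrix.of_apply, Fin.cons_zero, Fin.cons_succ]
        fun_prop
    · simp only [flowMatrix, Matrix.of_apply, Fin.cons_succ]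
      fun_prop
  exact this.continuousAt.comp hg

/-- Quantitative nondivergence: for most points of a ball the lattice has no short vector. -/
theorem NondegenerateOn.exists_volume_short_le {n : ℕ} (hn : 1 ≤ n) {d : Fin n → ℕ → ℝ → ℝ}
    {U : Set ℝ} {K : ℝ} (hd : NondegenerateOn d U K) {x₀ : ℝ}
    (hU : U ⊆ Metric.closedBall x₀ (1 / 2)) :
    ∃ ε : ℝ, 0 < ε ∧ ∀ y r, 0 < r → Metric.closedBall y (5 ^ (n + 1) * r) ⊆ U →
      ∃ Q₀ : ℝ, 1 ≤ Q₀ ∧ ∀ Q, Q₀ ≤ Q →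
        volume {x ∈ Metric.closedBall y r | ∃ v : Fin (n + 1) → ℤ, v ≠ 0 ∧
          ‖Matrix.vecMul (fun k => (v k : ℝ)) (flowMatrix Q fun i => d i 0 x)‖ < ε} ≤
            ENNReal.ofReal r := by
  obtain ⟨C, hC, h⟩ := exists_volume_not_isMarked_le (Submodule ℚ (Fin (n + 1) → ℚ)) (n + 1)
  set η : ℝ := 1 / (2 * (C.toReal + 1)) with hη
  have hη0 : 0 < η := by positivity
  obtain ⟨ε, hε, hε1, hgood⟩ := hd.exists_volume_covol_lt_le hn hU hη0
  refine ⟨ε / (n + 1), by positivity, ?_⟩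
  intro y r hr hyr
  have hyr' : Metric.closedBall y r ⊆ U :=
    (Metric.closedBall_subset_closedBall
      (le_mul_of_one_le_left hr.le (one_le_pow₀ (by norm_num)))).trans hyr
  obtain ⟨Q₀, hQ₀, hlarge⟩ := hd.exists_one_le_covol hn hr hyr'
  refine ⟨Q₀, hQ₀, fun Q hQ => ?_⟩
  have hvol := h (fun V x => covol (flowMatrix Q fun i => d i 0 x) V) ε (ENNReal.ofReal η) U
    (fun V x hx => continuousAt_covol (continuousAt_flowMatrix
      (continuousAt_pi.2 fun i => (hd.hasDerivAt i 0 hn x hx).continuousAt)) V)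
    (fun V y r hr hyr => hgood Q V y r hr hyr) (intSubspaces (n + 1))
    card_le_of_isChain_intSubspaces y r hr hyr (hlarge Q hQ)
  refine (measure_mono fun x hx => ?_).trans (hvol.trans ?_)
  · refine ⟨hx.1, fun hmark => ?_⟩
    obtain ⟨v, hv0, hv⟩ := hx.2
    have := hmark.le_norm_vecMul hε1 v hv0
    rw [lt_div_iff₀ (by positivity)] at hv
    push_cast at this
    linarith
  · rw [← ENNReal.ofReal_toReal hC, ← ENNReal.ofReal_mul ENNReal.toReal_nonneg,
      ← ENNReal.ofReal_mul (by positivity)]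
    refine ENNReal.ofReal_le_ofReal ?_
    have h0 : 0 ≤ C.toReal := ENNReal.toReal_nonneg
    have h1 : C.toReal * η * (2 * r) = r * (C.toReal / (C.toReal + 1)) := by
      rw [hη]; field_simp
    rw [h1]
    exact mul_le_of_le_one_right hr.le ((div_le_one (by positivity)).2 (by linarith))

/-- A set of volume greater than one contains two points differing by a nonzero integer vector. -/
lemma exists_sub_eq_intCast_of_one_lt_volume {N : ℕ} {s : Set (Fin N → ℝ)}
    (hs : MeasurableSet s) (h : 1 < volume s) :
    ∃ v : Fin N → ℤ, v ≠ 0 ∧ ∃ x ∈ s, ∃ y ∈ s, x - y = fun k => (v k : ℝ) := by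
  have hvol : volume (ZSpan.fundamentalDomain (Pi.basisFun ℝ (Fin N))) < volume s := by
    rw [ZSpan.fundamentalDomain_pi_basisFun, Real.volume_pi_Ico]
    simpa using h
  have : Countable (Submodule.span ℤ (range (Pi.basisFun ℝ (Fin N)))).toAddSubgroup :=
    inferInstanceAs (Countable (Submodule.span ℤ (range (Pi.basisFun ℝ (Fin N)))))
  obtain ⟨p, q, hpq, hnd⟩ := exists_pair_mem_lattice_not_disjoint_vadd
    (ZSpan.isAddFundamentalDomain' (Pi.basisFun ℝ (Fin N)) volume) hs.nullMeasurableSet hvol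
  obtain ⟨w, ⟨x, hx, hxw⟩, ⟨y, hy, hyw⟩⟩ := Set.not_disjoint_iff.1 hnd
  have hmem : (q : Fin N → ℝ) - p ∈ Submodule.span ℤ (range (Pi.basisFun ℝ (Fin N))) :=
    sub_mem q.2 p.2
  rw [Module.Basis.mem_span_iff_repr_mem] at hmem
  choose v hv using hmem
  have hvq : (q : Fin N → ℝ) - p = fun k => (v k : ℝ) := by
    ext k
    simpa using (hv k).symm
  refine ⟨v, ?_, x, hx, y, hy, ?_⟩
  · rintro rfl
    apply hpq
    have : (q : Fin N → ℝ) = p := by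
      rw [← sub_eq_zero, hvq]; ext k; simp
    exact Subtype.ext this.symm
  · rw [← hvq, sub_eq_sub_iff_add_eq_add]
    have h1 : (p : Fin N → ℝ) + x = q + y := hxw.trans hyw.symm
    rw [add_comm x, h1, add_comm]

/-- A unimodular lattice without short vectors has bounded covering radius. -/
lemma exists_norm_vecMul_sub_le (N : ℕ) {ε : ℝ} (hε : 0 < ε) :
    ∃ R : ℝ, 0 < R ∧ ∀ H : Matrix (Fin N) (Fin N) ℝ, H.det = 1 →
      (∀ v : Fin N → ℤ, v ≠ 0 → ε ≤ ‖Matrix.vecMul (fun k => (v k : ℝ)) H‖) →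
      ∀ T : Fin N → ℝ, ∃ v : Fin N → ℤ, ‖Matrix.vecMul (fun k => (v k : ℝ)) H - T‖ ≤ R := by
  set δ := ε / 3 with hδ
  have hδ0 : 0 < δ := by positivity
  obtain ⟨m, hm⟩ := exists_nat_gt (1 / (2 * δ) ^ N)
  have hm1 : 1 < m * (2 * δ) ^ N := by rwa [div_lt_iff₀ (by positivity)] at hm
  have hm0 : (0 : ℝ) < m := lt_trans (by positivity) hm
  refine ⟨m * ε, by positivity, fun H hdet hshort T => ?_⟩
  set Λ : Set (Fin N → ℝ) := range fun v : Fin N → ℤ => Matrix.vecMul (fun k => (v k : ℝ)) H with hΛ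
  have hzero : (0 : Fin N → ℝ) ∈ Λ := ⟨0, by
    have : (fun k : Fin N => (((0 : Fin N → ℤ) k : ℤ) : ℝ)) = 0 := by ext; simp
    simp only [this, Matrix.zero_vecMul]⟩
  by_contra! hcon
  have hT : m * ε ≤ Metric.infDist T Λ := by
    rw [Metric.le_infDist ⟨0, hzero⟩]
    rintro _ ⟨v, rfl⟩
    rw [dist_comm, dist_eq_norm]
    exact (hcon v).le
  have hinv : ∀ (v : Fin N → ℤ) (z : Fin N → ℝ),
      Metric.infDist (z + Matrix.vecMul (fun k => (v k : ℝ)) H) Λ = Metric.infDist z Λ := by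
    intro v z
    have himg : (fun w => w + Matrix.vecMul (fun k => (v k : ℝ)) H) '' Λ = Λ := by
      ext w
      constructor
      · rintro ⟨_, ⟨u, rfl⟩, rfl⟩
        refine ⟨u + v, ?_⟩
        simp only [← Matrix.add_vecMul]
        congr 1
        ext k; simp
      · rintro ⟨u, rfl⟩
        refine ⟨_, ⟨u - v, rfl⟩, ?_⟩
        simp only [← Matrix.add_vecMul]
        congr 1
        ext k; simp
    conv_lhs => rw [← himg]
    exact Metric.infDist_image (isometry_add_right (Matrix.vecMul (fun k => (v k : ℝ)) H))
  have hex : ∀ i : Fin m, ∃ y, Metric.infDist y Λ = i * ε := by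
    intro i
    refine mem_range_of_exists_le_of_exists_ge (Metric.continuous_infDist_pt Λ)
      ⟨0, ?_⟩ ⟨T, le_trans ?_ hT⟩
    · rw [Metric.infDist_zero_of_mem hzero]; positivity
    · have : (i : ℝ) ≤ m := by exact_mod_cast i.2.le
      gcongr
  choose y hy using hex
  have hball : ∀ i, ∀ z ∈ Metric.closedBall (y i) δ, |Metric.infDist z Λ - i * ε| ≤ δ := by
    intro i z hz
    rw [← hy i, abs_sub_le_iff]
    have h1 := Metric.infDist_le_infDist_add_dist (s := Λ) (x := z) (y := y i)
    have h2 := Metric.infDist_le_infDist_add_dist (s := Λ) (x := y i) (y := z)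
    rw [Metric.mem_closedBall] at hz
    rw [dist_comm] at h2
    constructor <;> linarith
  have heq : ∀ i j : Fin m, ∀ z ∈ Metric.closedBall (y i) δ, ∀ w ∈ Metric.closedBall (y j) δ,
      Metric.infDist z Λ = Metric.infDist w Λ → i = j := by
    intro i j z hz w hw hzw
    by_contra hij
    have h1 := hball i z hz
    have h2 := hball j w hw
    rw [hzw] at h1
    have h3 : (1 : ℝ) ≤ |(i : ℝ) - j| := by
      have : ((i : ℤ) - (j : ℤ)) ≠ 0 := by
        intro h; apply hij; ext; omega
      exact_mod_cast Int.one_le_abs this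
    have h4 : |(i : ℝ) - j| * ε ≤ δ + δ := by
      calc |(i : ℝ) - j| * ε = |((i : ℝ) - j) * ε| := by rw [abs_mul, abs_of_pos hε]
        _ = |(Metric.infDist w Λ - j * ε) - (Metric.infDist w Λ - i * ε)| := by
            congr 1; ring
        _ ≤ _ := (abs_sub _ _).trans (add_le_add h2 h1)
    nlinarith
  set s : Set (Fin N → ℝ) := ⋃ i, Metric.closedBall (y i) δ with hs
  have hsm : MeasurableSet s := MeasurableSet.iUnion fun i => Metric.isClosed_closedBall.measurableSet
  have hsvol : 1 < volume s := by
    rw [hs, measure_iUnion (fun i j hij => Set.disjoint_left.2 fun z hz hz' =>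
      hij (heq i j z hz z hz' rfl)) fun i => Metric.isClosed_closedBall.measurableSet]
    simp only [Real.volume_pi_closedBall _ hδ0.le, tsum_fintype, Finset.sum_const,
      Finset.card_univ, Fintype.card_fin, nsmul_eq_mul]
    rw [← ENNReal.ofReal_natCast, ← ENNReal.ofReal_mul hm0.le, ← ENNReal.ofReal_one]
    exact (ENNReal.ofReal_lt_ofReal_iff (by linarith)).2 hm1
  set f : (Fin N → ℝ) →ₗ[ℝ] (Fin N → ℝ) := Matrix.toLin' H.transpose with hf
  have hfv : ∀ x, f x = Matrix.vecMul x H := fun x => by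
    rw [hf, Matrix.toLin'_apply, Matrix.mulVec_transpose]
  have hfdet : LinearMap.det f = 1 := by rw [hf, LinearMap.det_toLin', Matrix.det_transpose, hdet]
  have hpre : 1 < volume (f ⁻¹' s) := by
    rw [Measure.addHaar_preimage_linearMap volume (by rw [hfdet]; exact one_ne_zero), hfdet]
    simpa using hsvol
  obtain ⟨v, hv0, x, hx, x', hx', hxx⟩ := exists_sub_eq_intCast_of_one_lt_volume
    (hsm.preimage f.continuous_of_finiteDimensional.measurable) hpre
  obtain ⟨i, hi⟩ := mem_iUnion.1 hx
  obtain ⟨j, hj⟩ := mem_iUnion.1 hx'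
  have hsub : f x = f x' + Matrix.vecMul (fun k => (v k : ℝ)) H := by
    rw [← hxx, ← hfv, ← map_add]; congr 1; abel
  have hij : i = j := heq i j _ hi _ hj (by rw [hsub, hinv])
  subst hij
  have h1 := hshort v hv0
  have h2 : ‖Matrix.vecMul (fun k => (v k : ℝ)) H‖ ≤ δ + δ := by
    have : Matrix.vecMul (fun k => (v k : ℝ)) H = f x - f x' := by rw [hsub]; abel
    rw [this, ← dist_eq_norm]
    exact (dist_triangle_right _ _ _).trans (add_le_add hi hj)
  linarith

/-- If the lattice at `x` has bounded covering radius, then some inhomogeneous linear form of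
height comparable to `Q` has a zero close to `x` and a derivative of size at most `Q`. -/
lemma exists_linearForm_zero {n : ℕ} {f f' : Fin n → ℝ → ℝ} {lam lam' : ℝ → ℝ} {U : Set ℝ}
    (hU : Convex ℝ U) (hf : ∀ i, ∀ x ∈ U, HasDerivAt (f i) (f' i x) x)
    (hlam : ∀ x ∈ U, HasDerivAt lam (lam' x) x) {B L R μ s : ℝ} (hB0 : 0 ≤ B) (hL0 : 0 ≤ L)
    (hB : ∀ i, ∀ x ∈ U, |f' i x| ≤ B) (hL : ∀ x ∈ U, |lam' x| ≤ L) (k : Fin n) (hs : |s| = 1)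
    (hμ : 0 < μ) (hk : ∀ x ∈ U, μ ≤ s * f' k x) (hR : 0 < R) :
    ∃ C : ℝ, 1 ≤ C ∧ ∀ Q, 1 ≤ Q → ∀ x, Metric.closedBall x (R / Q ^ (n + 1)) ⊆ U →
      (∀ T : Fin (n + 1) → ℝ, ∃ v : Fin (n + 1) → ℤ,
        ‖Matrix.vecMul (fun j => (v j : ℝ)) (flowMatrix Q fun i => f i x) - T‖ ≤ R) →
      ∃ z ∈ Metric.closedBall x (R / Q ^ (n + 1)), ∃ (p : ℤ) (c : Fin n → ℤ),
        (∀ i, |(c i : ℝ)| ≤ C * Q) ∧ Q ≤ |(c k : ℝ)| ∧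
          ∀ y ∈ U, |p + ∑ i, (c i : ℝ) * f i y + lam y| ≤ C * Q * |y - z| := by
  set t : ℝ := R + 1 + (n * R * B + 1 + L) / μ with ht
  have htR : 1 ≤ t - R := by
    have : 0 ≤ (n * R * B + 1 + L) / μ := by positivity
    linarith
  have ht0 : 0 ≤ t := by linarith
  have htμ : n * R * B + 1 + L ≤ (t - R) * μ := by
    have h1 : (t - R) * μ = μ + (n * R * B + 1 + L) := by rw [ht]; field_simp; ring
    linarith
  refine ⟨n * (R + t) * B + L + (R + t) + 1, ?_, ?_⟩
  · have : 0 ≤ n * (R + t) * B := by positivity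
    linarith
  set C : ℝ := n * (R + t) * B + L + (R + t) + 1 with hC
  intro Q hQ x hx hcov
  have hQ0 : 0 < Q := by linarith
  have hss : s * s = 1 := by rw [← abs_mul_abs_self, hs, one_mul]
  obtain ⟨v, hv⟩ := hcov (Fin.cons (-(Q ^ n * lam x)) (Pi.single k (t * s)))
  rw [pi_norm_le_iff_of_nonneg hR.le] at hv
  set c : Fin n → ℤ := fun i => v i.succ with hc
  have hv0 := hv 0
  rw [Pi.sub_apply, vecMul_flowMatrix_zero, Fin.cons_zero, Real.norm_eq_abs] at hv0
  have hvs : ∀ i, |Q⁻¹ * (c i : ℝ) - (Pi.single k (t * s) : Fin n → ℝ) i| ≤ R := by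
    intro i
    have := hv i.succ
    rwa [Pi.sub_apply, vecMul_flowMatrix_succ, Fin.cons_succ, Real.norm_eq_abs] at this
  have hci : ∀ i, i ≠ k → |(c i : ℝ)| ≤ R * Q := by
    intro i hi
    have := hvs i
    rwa [Pi.single_eq_of_ne hi, sub_zero, abs_mul, abs_of_pos (inv_pos.2 hQ0),
      inv_mul_le_iff₀ hQ0, mul_comm Q] at this
  have hckabs : |(c k : ℝ) - t * s * Q| ≤ R * Q := by
    have := hvs k
    rw [Pi.single_eq_same] at this
    have h1 : (c k : ℝ) - t * s * Q = (Q⁻¹ * (c k : ℝ) - t * s) * Q := by field_simp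
    rw [h1, abs_mul, abs_of_pos hQ0]
    gcongr
  have hck : (t - R) * Q ≤ s * c k := by
    have h1 : |s * c k - t * Q| ≤ R * Q := by
      have : s * c k - t * Q = s * ((c k : ℝ) - t * s * Q) := by linear_combination t * Q * hss
      rw [this, abs_mul, hs, one_mul]
      exact hckabs
    linarith [(abs_le.1 h1).1]
  have hcall : ∀ i, |(c i : ℝ)| ≤ (R + t) * Q := by
    intro i
    by_cases hi : i = k
    · subst hi
      have h1 : |t * s * Q| = t * Q := by
        rw [abs_mul, abs_mul, hs, abs_of_nonneg ht0, abs_of_pos hQ0, mul_one]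
      have h2 := abs_sub_abs_le_abs_sub (c i : ℝ) (t * s * Q)
      linarith
    · refine (hci i hi).trans ?_
      gcongr
      linarith
  set F : ℝ → ℝ := fun y => (v 0 : ℝ) + ∑ i, (c i : ℝ) * f i y + lam y with hF
  set F' : ℝ → ℝ := fun y => ∑ i, (c i : ℝ) * f' i y + lam' y with hF'
  have hder : ∀ y ∈ U, HasDerivAt F (F' y) y := by
    intro y hy
    have h1 : HasDerivAt (fun w => ∑ i, (c i : ℝ) * f i w) (∑ i, (c i : ℝ) * f' i y) y :=
      HasDerivAt.fun_sum fun i _ => (hf i y hy).const_mul _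
    exact (h1.const_add _).add (hlam y hy)
  have hF'le : ∀ y ∈ U, |F' y| ≤ C * Q := by
    intro y hy
    calc |F' y| ≤ |∑ i, (c i : ℝ) * f' i y| + |lam' y| := abs_add_le _ _
      _ ≤ ∑ _i : Fin n, (R + t) * Q * B + L := by
          refine add_le_add ((Finset.abs_sum_le_sum_abs _ _).trans
            (Finset.sum_le_sum fun i _ => ?_)) (hL y hy)
          rw [abs_mul]
          exact mul_le_mul (hcall i) (hB i y hy) (abs_nonneg _) (by positivity)
      _ ≤ C * Q := by
          have h1 : L ≤ L * Q := le_mul_of_one_le_right hL0 hQ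
          have h2 : 0 ≤ (R + t) * Q + Q := by positivity
          simp only [Finset.sum_const, Finset.card_univ, Fintype.card_fin, nsmul_eq_mul, hC]
          linarith
  have hF'ge : ∀ y ∈ U, Q ≤ F' y := by
    intro y hy
    have h1 : F' y = s * c k * (s * f' k y) +
        (∑ i ∈ Finset.univ.erase k, (c i : ℝ) * f' i y + lam' y) := by
      simp only [hF']
      rw [← Finset.add_sum_erase _ _ (Finset.mem_univ k)]
      linear_combination (-(c k : ℝ) * f' k y) * hss
    have h2 : (t - R) * Q * μ ≤ s * c k * (s * f' k y) :=
      mul_le_mul hck (hk y hy) hμ.le (le_trans (by positivity) hck)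
    have h3 : |∑ i ∈ Finset.univ.erase k, (c i : ℝ) * f' i y| ≤ n * (R * Q * B) := by
      calc _ ≤ ∑ i ∈ Finset.univ.erase k, R * Q * B := by
            refine (Finset.abs_sum_le_sum_abs _ _).trans (Finset.sum_le_sum fun i hi => ?_)
            rw [abs_mul]
            exact mul_le_mul (hci i (Finset.ne_of_mem_erase hi)) (hB i y hy) (abs_nonneg _)
              (by positivity)
        _ ≤ n * (R * Q * B) := by
            rw [Finset.sum_const, nsmul_eq_mul]
            gcongr
            exact (Finset.card_le_univ _).trans (by simp)
    have h5 : (n * R * B + 1 + L) * Q ≤ (t - R) * μ * Q := by gcongr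
    have h6 : L ≤ L * Q := le_mul_of_one_le_right hL0 hQ
    have h7 := (abs_le.1 h3).1
    have h8 := (abs_le.1 (hL y hy)).1
    rw [h1]
    linarith
  set ρ : ℝ := R / Q ^ (n + 1) with hρ
  have hρ0 : 0 < ρ := by positivity
  have hQρ : Q * ρ = R / Q ^ n := by rw [hρ, pow_succ]; field_simp
  have hFx : |F x| ≤ Q * ρ := by
    rw [hQρ, le_div_iff₀ (by positivity), mul_comm, ← abs_of_pos (pow_pos hQ0 n), ← abs_mul]
    refine le_trans (le_of_eq ?_) hv0
    congr 1
    have : ∑ i, f i x * (v i.succ : ℝ) = ∑ i, (c i : ℝ) * f i x :=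
      Finset.sum_congr rfl fun i _ => mul_comm _ _
    rw [this, hF]
    ring
  have hslope : ∀ y w, y ∈ Metric.closedBall x ρ → w ∈ Metric.closedBall x ρ → y < w →
      Q * (w - y) ≤ F w - F y := by
    intro y w hy hw hyw
    have hsub : Icc y w ⊆ U := by
      rw [Real.closedBall_eq_Icc] at hy hw
      exact (Icc_subset_Icc hy.1 hw.2).trans (by rwa [← Real.closedBall_eq_Icc])
    obtain ⟨ξ, hξ, heq⟩ := exists_hasDerivAt_eq_slope F F' hyw
      (fun u hu => (hder u (hsub hu)).continuousAt.continuousWithinAt)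
      (fun u hu => hder u (hsub (Ioo_subset_Icc_self hu)))
    have h1 := hF'ge ξ (hsub (Ioo_subset_Icc_self hξ))
    have hpos : 0 < w - y := by linarith
    rw [eq_div_iff hpos.ne'] at heq
    rw [← heq]
    gcongr
  have hmem : x ∈ Metric.closedBall x ρ := Metric.mem_closedBall_self hρ0.le
  have hmeml : x - ρ ∈ Metric.closedBall x ρ := by
    rw [Real.closedBall_eq_Icc]; constructor <;> linarith
  have hmemr : x + ρ ∈ Metric.closedBall x ρ := by
    rw [Real.closedBall_eq_Icc]; constructor <;> linarith
  have hl := hslope _ _ hmeml hmem (by linarith)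
  have hr := hslope _ _ hmem hmemr (by linarith)
  have hivt := intermediate_value_Icc (f := F) (by linarith : x - ρ ≤ x + ρ)
    (fun u hu => ((hder u (hx (by rwa [Real.closedBall_eq_Icc]))).continuousAt).continuousWithinAt)
  obtain ⟨z, hz, hFz⟩ := hivt (show (0 : ℝ) ∈ Icc (F (x - ρ)) (F (x + ρ)) from
    ⟨by linarith [(abs_le.1 hFx).2], by linarith [(abs_le.1 hFx).1]⟩)
  rw [← Real.closedBall_eq_Icc] at hz
  refine ⟨z, hz, v 0, c, fun i => (hcall i).trans ?_, ?_, fun y hy => ?_⟩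
  · have : 0 ≤ n * (R + t) * B + L + 1 := by positivity
    gcongr
    linarith
  · calc Q ≤ (t - R) * Q := le_mul_of_one_le_left hQ0.le htR
      _ ≤ s * c k := hck
      _ ≤ |s * c k| := le_abs_self _
      _ = |(c k : ℝ)| := by rw [abs_mul, hs, one_mul]
  · have := hU.norm_image_sub_le_of_norm_hasDerivWithin_le
      (fun w hw => (hder w hw).hasDerivWithinAt) hF'le (hx hz) hy
    rwa [hFz, sub_zero] at this

/-- The points admitting an approximation of height greater than `N`. -/
def approximableSet {n : ℕ} (f : Fin n → ℝ → ℝ) (lam ψ : ℝ → ℝ) (N : ℕ) : Set ℝ :=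
  {x | ∃ c : Fin n → ℤ, N < (Finset.univ.sup fun i => (c i).natAbs) ∧
    nearestIntDist ((∑ i, (c i : ℝ) * f i x) + lam x) <
      ψ ((Finset.univ.sup fun i => (c i).natAbs : ℕ) : ℝ)}

lemma nearestIntDist_le_abs_add (x : ℝ) (p : ℤ) : nearestIntDist x ≤ |p + x| := by
  have := round_le x (-p)
  simpa [nearestIntDist, add_comm] using this

lemma abs_le_sup_natAbs {n : ℕ} (c : Fin n → ℤ) (k : Fin n) :
    |(c k : ℝ)| ≤ ((Finset.univ.sup fun i => (c i).natAbs : ℕ) : ℝ) := by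
  rw [← Int.cast_abs, Int.abs_eq_natAbs, Int.cast_natCast]
  exact_mod_cast Finset.le_sup (f := fun i => (c i).natAbs) (Finset.mem_univ k)

lemma sup_natAbs_le {n : ℕ} (c : Fin n → ℤ) {M : ℝ} (hM : 0 ≤ M) (h : ∀ i, |(c i : ℝ)| ≤ M) :
    ((Finset.univ.sup fun i => (c i).natAbs : ℕ) : ℝ) ≤ M := by
  refine le_trans ?_ (Nat.floor_le hM)
  rw [Nat.cast_le]
  refine Finset.sup_le fun i _ => Nat.le_floor ?_
  have := h i
  rwa [← Int.cast_abs, Int.abs_eq_natAbs, Int.cast_natCast] at this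

/-- Near a zero of a linear form of height comparable to `Q`, every point is well approximable. -/
lemma closedBall_subset_approximableSet {n N : ℕ} {f : Fin n → ℝ → ℝ} {lam ψ : ℝ → ℝ}
    (hψ : AntitoneOn ψ (Ioi 0)) {C Q ρ z : ℝ} (hC : 1 ≤ C) (hQ : 1 ≤ Q) (hNQ : N < Q)
    {p : ℤ} {c : Fin n → ℤ} {k : Fin n} (hc : ∀ i, |(c i : ℝ)| ≤ C * Q) (hck : Q ≤ |(c k : ℝ)|)
    (hz : ∀ y ∈ Metric.closedBall z ρ, |p + ∑ i, (c i : ℝ) * f i y + lam y| ≤ C * Q * |y - z|)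
    (hρ : C * Q * ρ < ψ (C * Q)) : Metric.closedBall z ρ ⊆ approximableSet f lam ψ N := by
  intro y hy
  have hlow := hck.trans (abs_le_sup_natAbs c k)
  have hup := sup_natAbs_le c (by positivity) hc
  refine ⟨c, by exact_mod_cast hNQ.trans_le hlow, ?_⟩
  have hmem : ((Finset.univ.sup fun i => (c i).natAbs : ℕ) : ℝ) ∈ Ioi (0 : ℝ) :=
    lt_of_lt_of_le (by linarith) hlow
  have hmem' : C * Q ∈ Ioi (0 : ℝ) := mem_Ioi.2 (by positivity)
  refine (nearestIntDist_le_abs_add _ p).trans_lt (lt_of_le_of_lt ?_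
    (hρ.trans_le (hψ hmem hmem' hup)))
  rw [← add_assoc]
  refine (hz y hy).trans ?_
  have : |y - z| ≤ ρ := hy
  gcongr

lemma exists_separated_finset {A : Set ℝ} {y r Δ ρ δ : ℝ} (hr : 0 < r) (hΔ : 0 < Δ) (hδ : 0 < δ)
    (hΔδ : δ + 2 * ρ ≤ Δ) (hA : A ⊆ Metric.closedBall y r) (hvol : ENNReal.ofReal r ≤ volume A)
    {P : ℝ → Prop} (hP : ∀ x ∈ A, ∃ z ∈ Metric.closedBall x ρ, P z) :
    ∃ X : Finset ℝ, (∀ x ∈ X, ∀ x' ∈ X, x ≠ x' → δ ≤ |x - x'|) ∧ r / (2 * Δ) ≤ X.card ∧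
      ∀ z ∈ X, z ∈ Metric.closedBall y (r + ρ) ∧ P z := by
  have hpos : 0 < r / (2 * Δ) := by positivity
  set m : ℕ := ⌈r / (2 * Δ)⌉₊ - 1 with hm
  have hceil : 0 < ⌈r / (2 * Δ)⌉₊ := Nat.ceil_pos.2 hpos
  have hm1 : r / (2 * Δ) ≤ (m + 1 : ℕ) := by
    rw [hm, Nat.sub_add_cancel hceil]; exact Nat.le_ceil _
  have hm2 : (m : ℝ) < r / (2 * Δ) := by
    rw [← Nat.lt_ceil]; omega
  have hbdd : BddBelow A := by
    refine BddBelow.mono hA ?_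
    rw [Real.closedBall_eq_Icc]; exact bddBelow_Icc
  rcases exists_separated_or_volume_le m hΔ A hbdd with ⟨x, hx, hgap⟩ | hle
  · choose! z hz hPz using hP
    have hmono : ∀ i j, i < j → j ≤ m → x i + Δ ≤ x j := by
      intro i j hij
      induction j, hij using Nat.le_induction with
      | base => intro h; exact hgap i (by omega)
      | succ j hj ih =>
        intro h
        linarith [ih (by omega), hgap j (by omega)]
    have hzgap : ∀ i j, i < j → j ≤ m → z (x i) + δ ≤ z (x j) := by
      intro i j hij hj
      have h1 := hz _ (hx i (by omega))
      have h2 := hz _ (hx j hj)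
      rw [Real.closedBall_eq_Icc] at h1 h2
      linarith [h1.2, h2.1, hmono i j hij hj]
    have hsep : ∀ i ≤ m, ∀ j ≤ m, i ≠ j → δ ≤ |z (x i) - z (x j)| := by
      intro i hi j hj hij
      rcases lt_or_gt_of_ne hij with h | h
      · rw [abs_sub_comm]
        exact le_trans (by linarith [hzgap i j h hj]) (le_abs_self _)
      · exact le_trans (by linarith [hzgap j i h hi]) (le_abs_self _)
    refine ⟨(Finset.range (m + 1)).image fun i => z (x i), ?_, ?_, ?_⟩
    · intro a ha b hb hab
      obtain ⟨i, hi, rfl⟩ := Finset.mem_image.1 ha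
      obtain ⟨j, hj, rfl⟩ := Finset.mem_image.1 hb
      rw [Finset.mem_range] at hi hj
      exact hsep i (by omega) j (by omega) fun h => hab (by rw [h])
    · rw [Finset.card_image_of_injOn, Finset.card_range]
      · exact hm1
      · intro i hi j hj hij
        by_contra hne
        rw [Finset.mem_coe, Finset.mem_range] at hi hj
        have := hsep i (by omega) j (by omega) hne
        simp only at hij
        rw [hij, sub_self, abs_zero] at this
        linarith
    · intro a ha
      obtain ⟨i, hi, rfl⟩ := Finset.mem_image.1 ha
      rw [Finset.mem_range] at hi
      have hxi := hx i (by omega)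
      refine ⟨?_, hPz _ hxi⟩
      have h1 := hz _ hxi
      have h2 := hA hxi
      rw [Metric.mem_closedBall] at h1 h2 ⊢
      linarith [dist_triangle (z (x i)) (x i) y]
  · exfalso
    have h1 := (ENNReal.ofReal_le_ofReal_iff (by positivity)).1 (hvol.trans hle)
    rw [lt_div_iff₀ (by positivity)] at hm2
    linarith

theorem NondegenerateOn.le_dimH {n : ℕ} (hn : 1 ≤ n) {d : Fin n → ℕ → ℝ → ℝ}
    {lam lam' ψ : ℝ → ℝ} {x₀ r₁ K : ℝ} (hr₁ : 0 < r₁) (hr₁' : r₁ ≤ 1 / 2)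
    (hd : NondegenerateOn d (Metric.closedBall x₀ r₁) K)
    (hlam : ∀ x ∈ Metric.closedBall x₀ r₁, HasDerivAt lam (lam' x) x) {B L μ s : ℝ}
    (hB : ∀ i, ∀ x ∈ Metric.closedBall x₀ r₁, |d i 1 x| ≤ B)
    (hL : ∀ x ∈ Metric.closedBall x₀ r₁, |lam' x| ≤ L) (k : Fin n) (hs : |s| = 1) (hμ : 0 < μ)
    (hk : ∀ x ∈ Metric.closedBall x₀ r₁, μ ≤ s * d k 1 x) (hψ : AntitoneOn ψ (Ioi 0))
    {σ τ : ℝ} (hστ : σ < τ) (hnτ : (n : ℝ) ≤ τ)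
    (hfreq : ∃ᶠ q : ℝ in atTop, q ^ (-σ) ≤ ψ q) :
    ENNReal.ofReal (((n : ℝ) + 1) / (τ + 1)) ≤
      dimH (Metric.closedBall x₀ (r₁ / (5 ^ (n + 1) + 1)) ∩
        ⋂ N, approximableSet (fun i => d i 0) lam ψ N) := by
  have hx₀ : x₀ ∈ Metric.closedBall x₀ r₁ := Metric.mem_closedBall_self hr₁.le
  have hB0 : 0 ≤ B := (abs_nonneg _).trans (hB k x₀ hx₀)
  have hL0 : 0 ≤ L := (abs_nonneg _).trans (hL x₀ hx₀)
  obtain ⟨ε, hε, hshort⟩ := hd.exists_volume_short_le hn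
    (Metric.closedBall_subset_closedBall hr₁')
  obtain ⟨R, hR, hcover⟩ := exists_norm_vecMul_sub_le (n + 1) hε
  obtain ⟨C, hC, hform⟩ := exists_linearForm_zero (convex_closedBall x₀ r₁)
    (fun i x hx => hd.hasDerivAt i 0 hn x hx) hlam hB0 hL0 hB hL k hs hμ hk hR
  have hC0 : 0 < C := by linarith
  have hn1 : (0 : ℝ) < n + 1 := by positivity
  have hτ1 : 0 < τ + 1 := by linarith
  have ht1 : 1 ≤ (τ + 1) / (n + 1) := (one_le_div hn1).2 (by linarith)
  rw [← one_div_div]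
  refine le_dimH_of_ubiquity (κ := 1 / (4 * (2 * R + 1))) (by positivity) (by positivity) ht1 ?_
  intro N y r hr hyr δ₀ hδ₀
  have hyr₁ : Metric.closedBall y (5 ^ (n + 1) * (r / 2)) ⊆ Metric.closedBall x₀ r₁ := by
    have h1 : y + r ∈ Metric.closedBall y r := by rw [Real.closedBall_eq_Icc]; constructor <;> linarith
    have h2 : y - r ∈ Metric.closedBall y r := by rw [Real.closedBall_eq_Icc]; constructor <;> linarith
    have h1' := hyr h1
    have h2' := hyr h2
    rw [Real.closedBall_eq_Icc] at h1' h2'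
    set ρ := r₁ / (5 ^ (n + 1) + 1) with hρ
    have hρr : (5 ^ (n + 1) + 1) * ρ = r₁ := by rw [hρ]; field_simp
    have hrρ : r ≤ ρ := by linarith [h1'.2, h2'.1]
    refine Metric.closedBall_subset_closedBall' ?_
    have hdist : dist y x₀ ≤ ρ := by
      rw [Real.dist_eq, abs_le]
      constructor <;> linarith [h1'.2, h2'.1]
    have h3 : (5 : ℝ) ^ (n + 1) * (r / 2) ≤ 5 ^ (n + 1) * ρ := by
      gcongr
      linarith
    linarith
  have hyr₀ : Metric.closedBall y r ⊆ Metric.closedBall x₀ r₁ :=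
    hyr.trans (Metric.closedBall_subset_closedBall (div_le_self hr₁.le (by
      have : (0 : ℝ) < 5 ^ (n + 1) := by positivity
      linarith)))
  obtain ⟨Q₀, hQ₀, hvol⟩ := hshort y (r / 2) (by positivity) hyr₁
  have hlim : Tendsto (fun Q : ℝ => Q ^ (n + 1)) atTop atTop := tendsto_pow_atTop (by omega)
  have hev : ∀ᶠ Q : ℝ in atTop, Q₀ ≤ Q ∧ (N : ℝ) < Q ∧ 2 * (R + 1) / r ≤ Q ^ (n + 1) ∧
      1 / δ₀ < Q ^ (n + 1) ∧ C * C ^ σ < Q ^ (τ - σ) :=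
    (eventually_ge_atTop Q₀).and ((eventually_gt_atTop (N : ℝ)).and
      ((hlim.eventually_ge_atTop _).and ((hlim.eventually_gt_atTop _).and
        ((tendsto_rpow_atTop (by linarith : 0 < τ - σ)).eventually_gt_atTop _))))
  have hdiv : Tendsto (fun q : ℝ => q / C) atTop atTop := tendsto_id.atTop_div_const hC0
  obtain ⟨q, hqψ, hQQ₀, hNQ, hQr, hQδ, hQσ⟩ := (hfreq.and_eventually (hdiv.eventually hev)).exists
  set Q := q / C with hQ
  have hqQ : q = C * Q := by rw [hQ]; field_simp
  have hQ1 : 1 ≤ Q := hQ₀.trans hQQ₀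
  have hQ0 : 0 < Q := by linarith
  set δ : ℝ := 1 / Q ^ (n + 1) with hδ
  have hδ0 : 0 < δ := by positivity
  have hδ1 : δ ≤ 1 := (div_le_one (by positivity)).2 (one_le_pow₀ hQ1)
  have hδr : (R + 1) * δ ≤ r / 2 := by
    rw [div_le_iff₀ hr] at hQr
    rw [hδ, mul_one_div, div_le_iff₀ (by positivity)]
    linarith
  have hRδ : R / Q ^ (n + 1) = R * δ := by rw [hδ, mul_one_div]
  have hδt : δ ^ ((τ + 1) / (n + 1)) = Q ^ (-(τ + 1)) := by
    rw [hδ, one_div, ← Real.rpow_natCast, ← Real.rpow_neg hQ0.le, ← Real.rpow_mul hQ0.le]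
    congr 1
    push_cast
    field_simp
  have hδtle : δ ^ ((τ + 1) / (n + 1)) ≤ δ := by
    simpa using Real.rpow_le_rpow_of_exponent_ge hδ0 hδ1 ht1
  have hρψ : C * Q * δ ^ ((τ + 1) / (n + 1)) < ψ (C * Q) := by
    rw [← hqQ]
    refine lt_of_lt_of_le ?_ hqψ
    rw [hδt, hqQ, Real.mul_rpow hC0.le hQ0.le]
    have e1 : Q * Q ^ (-(τ + 1)) = Q ^ (-τ) := by
      nth_rw 1 [← Real.rpow_one Q]
      rw [← Real.rpow_add hQ0]; congr 1; ring
    have e2 : Q ^ (-σ) = Q ^ (τ - σ) * Q ^ (-τ) := by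
      rw [← Real.rpow_add hQ0]; congr 1; ring
    rw [mul_assoc, e1, e2, Real.rpow_neg hC0.le, ← mul_assoc]
    gcongr
    rw [lt_inv_mul_iff₀ (by positivity), mul_comm]
    exact hQσ
  refine ⟨δ, hδ0, ?_, ?_⟩
  · rw [hδ, div_lt_iff₀ (by positivity)]
    rw [div_lt_iff₀ hδ₀] at hQδ
    linarith
  set A : Set ℝ := Metric.closedBall y (r / 2) \ {x ∈ Metric.closedBall y (r / 2) |
    ∃ v : Fin (n + 1) → ℤ, v ≠ 0 ∧
      ‖Matrix.vecMul (fun k => (v k : ℝ)) (flowMatrix Q fun i => d i 0 x)‖ < ε} with hA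
  have hAvol : ENNReal.ofReal (r / 2) ≤ volume A := by
    have h1 := (tsub_le_tsub_left (hvol Q hQQ₀) (volume (Metric.closedBall y (r / 2)))).trans
      (le_measure_sdiff (μ := volume))
    rw [Real.volume_closedBall, ← ENNReal.ofReal_sub _ (by positivity)] at h1
    refine le_trans (le_of_eq ?_) h1
    congr 1; ring
  obtain ⟨X, hXsep, hXcard, hX⟩ := exists_separated_finset (Δ := (2 * R + 1) * δ) (ρ := R * δ)
    (δ := δ) (P := fun z => ∃ (p : ℤ) (c : Fin n → ℤ),
        (∀ i, |(c i : ℝ)| ≤ C * Q) ∧ Q ≤ |(c k : ℝ)| ∧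
          ∀ y ∈ Metric.closedBall x₀ r₁, |p + ∑ i, (c i : ℝ) * d i 0 y + lam y| ≤ C * Q * |y - z|)
    (by positivity : 0 < r / 2) (by positivity) hδ0 (by linarith) sdiff_subset hAvol
    (fun x hx => by
      have hsub : Metric.closedBall x (R / Q ^ (n + 1)) ⊆ Metric.closedBall x₀ r₁ := by
        refine subset_trans (Metric.closedBall_subset_closedBall' ?_) hyr₀
        have := Metric.mem_closedBall.1 hx.1
        rw [hRδ]
        linarith
      rw [← hRδ]
      refine hform Q hQ1 x hsub (hcover _ (det_flowMatrix hQ0.ne' _) fun v hv => ?_)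
      by_contra! hlt
      exact hx.2 ⟨hx.1, v, hv, hlt⟩)
  refine ⟨X, hXsep, ?_, ?_⟩
  · have : r / 2 / (2 * ((2 * R + 1) * δ)) * δ = 1 / (4 * (2 * R + 1)) * r := by
      field_simp; norm_num
    rw [← this]
    gcongr
  · intro z hz
    obtain ⟨hzy, p, c, hc, hck, hlin⟩ := hX z hz
    have hball : Metric.closedBall z (δ ^ ((τ + 1) / (n + 1))) ⊆ Metric.closedBall y r := by
      refine Metric.closedBall_subset_closedBall' ?_
      have := Metric.mem_closedBall.1 hzy
      linarith
    exact subset_inter hball (closedBall_subset_approximableSet hψ hC hQ1 hNQ hc hck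
      (fun w hw => hlin w (hyr₀ (hball hw))) hρψ)

lemma eventually_forall_mem_closedBall {α : Type*} [PseudoMetricSpace α] {x₀ : α} {P : α → Prop}
    (h : ∀ᶠ x in nhds x₀, P x) :
    ∀ᶠ r : ℝ in nhdsWithin 0 (Ioi 0), ∀ x ∈ Metric.closedBall x₀ r, P x := by
  obtain ⟨ε, hε, hεP⟩ := Metric.nhds_basis_closedBall.eventually_iff.1 h
  filter_upwards [Ioc_mem_nhdsGT hε] with r hr x hx
  exact hεP (Metric.closedBall_subset_closedBall hr.2 hx)

/-- Maps with nonvanishing Wronskian are nondegenerate on small balls. -/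
lemma exists_eventually_nondegenerateOn {n : ℕ} {a b x₀ : ℝ} (hx₀ : x₀ ∈ Ioo a b)
    {f : Fin n → ℝ → ℝ} (hf : ∀ i, ContDiffOn ℝ n (f i) (Icc a b))
    (hW : (Matrix.of fun i j : Fin n =>
      iteratedDerivWithin ((j : ℕ) + 1) (f i) (Icc a b) x₀).det ≠ 0) :
    ∃ K, ∀ᶠ r : ℝ in nhdsWithin 0 (Ioi 0), NondegenerateOn
      (fun i j => iteratedDerivWithin j (f i) (Icc a b)) (Metric.closedBall x₀ r) K := by
  have hu : UniqueDiffOn ℝ (Icc a b) := uniqueDiffOn_Icc (hx₀.1.trans hx₀.2)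
  have hcont : ∀ i, ∀ j ≤ n, ContinuousAt (iteratedDerivWithin j (f i) (Icc a b)) x₀ :=
    fun i j hj => ((hf i).continuousOn_iteratedDerivWithin (by exact_mod_cast hj) hu).continuousAt
      (Icc_mem_nhds hx₀.1 hx₀.2)
  set A : (Fin n → ℝ) → Matrix (Fin n) (Fin n) ℝ := fun ξ => Matrix.of fun i j =>
    iteratedDerivWithin ((j : ℕ) + 1) (f i) (Icc a b) (ξ j) with hA
  have hAc : ContinuousAt A (fun _ => x₀) := by
    refine continuousAt_pi.2 fun i => continuousAt_pi.2 fun j => ?_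
    exact ContinuousAt.comp (g := iteratedDerivWithin ((j : ℕ) + 1) (f i) (Icc a b))
      (f := fun ξ : Fin n → ℝ => ξ j) (x := fun _ => x₀) (hcont i (j + 1) j.2)
      (continuous_apply j).continuousAt
  have hdet : (A fun _ => x₀).det ≠ 0 := hW
  have hdetc : ContinuousAt (fun ξ => (A ξ).det) (fun _ => x₀) :=
    (continuous_id.matrix_det).continuousAt.comp hAc
  have hadjc : ContinuousAt (fun ξ => (A ξ).adjugate) (fun _ => x₀) :=
    (continuous_id.matrix_adjugate).continuousAt.comp hAc
  set g : (Fin n → ℝ) → ℝ := fun ξ => ∑ i, ∑ j, |(A ξ).adjugate j i| / |(A ξ).det| with hg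
  have hgc : ContinuousAt g (fun _ => x₀) := by
    refine tendsto_finsetSum _ fun i _ => tendsto_finsetSum _ fun j _ => ?_
    exact ContinuousAt.div (((continuous_apply_apply j i).continuousAt.comp hadjc).abs)
      hdetc.abs (abs_ne_zero.2 hdet)
  set K := g (fun _ => x₀) + 1 + ∑ i, (|iteratedDerivWithin n (f i) (Icc a b) x₀| + 1) with hK
  have hg0 : ∀ ξ, 0 ≤ g ξ := fun ξ => by positivity
  have hS0 : 0 ≤ ∑ i, (|iteratedDerivWithin n (f i) (Icc a b) x₀| + 1) := by positivity
  have hbound : ∀ᶠ x in nhds x₀, ∀ i, |iteratedDerivWithin n (f i) (Icc a b) x| ≤ K := by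
    refine eventually_all.2 fun i => ?_
    filter_upwards [(hcont i n le_rfl).abs.eventually (gt_mem_nhds (lt_add_one _))] with x hx
    have := Finset.single_le_sum
      (f := fun i => |iteratedDerivWithin n (f i) (Icc a b) x₀| + 1)
      (fun i _ => by positivity) (Finset.mem_univ i)
    have := hg0 fun _ => x₀
    linarith
  refine ⟨K, ?_⟩
  filter_upwards [eventually_forall_mem_closedBall hbound,
    eventually_forall_mem_closedBall (isOpen_Ioo.mem_nhds hx₀),
    eventually_forall_mem_closedBall (hdetc.eventually_ne hdet),
    eventually_forall_mem_closedBall (hgc.eventually (gt_mem_nhds (lt_add_one _))),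
    self_mem_nhdsWithin] with r h1 h2 h3 h4 hr
  refine ⟨fun i j hj x hx => ?_, fun i x hx => h1 x hx i, fun ξ hξ c η hη i => ?_⟩
  · have hmem := Icc_mem_nhds (h2 x hx).1 (h2 x hx).2
    have := ((hf i).differentiableOn_iteratedDerivWithin (by exact_mod_cast hj) hu
      x (Ioo_subset_Icc_self (h2 x hx))).hasDerivWithinAt.hasDerivAt hmem
    rwa [← iteratedDerivWithin_succ] at this
  · have hξ' : ξ ∈ Metric.closedBall (fun _ => x₀) r :=
      Metric.mem_closedBall.2 ((dist_pi_le_iff (le_of_lt hr)).2 fun j => hξ j)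
    have hη0 : 0 ≤ η := (abs_nonneg _).trans (hη i)
    have hd := h3 ξ hξ'
    have key : (A ξ).det * c i = ∑ j, Matrix.vecMul c (A ξ) j * (A ξ).adjugate j i := by
      have : Matrix.vecMul (Matrix.vecMul c (A ξ)) (A ξ).adjugate = (A ξ).det • c := by
        rw [Matrix.vecMul_vecMul, Matrix.mul_adjugate, Matrix.vecMul_smul, Matrix.vecMul_one]
      simpa [Matrix.vecMul, dotProduct] using (congrFun this i).symm
    have hci : |c i| ≤ (∑ j, |(A ξ).adjugate j i| / |(A ξ).det|) * η := by
      rw [← Finset.sum_div, div_mul_eq_mul_div, le_div_iff₀ (abs_pos.2 hd), mul_comm, ← abs_mul,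
        key, Finset.sum_mul]
      refine (Finset.abs_sum_le_sum_abs _ _).trans (Finset.sum_le_sum fun j _ => ?_)
      rw [abs_mul, mul_comm]
      gcongr
      simpa [Matrix.vecMul, dotProduct, hA] using hη j
    refine hci.trans (mul_le_mul_of_nonneg_right ?_ hη0)
    have hsingle := Finset.single_le_sum
      (f := fun i => ∑ j, |(A ξ).adjugate j i| / |(A ξ).det|)
      (fun i _ => by positivity) (Finset.mem_univ i)
    have hlt := h4 ξ hξ'
    simp only [hg] at hlt
    simp only [hK, hg] at hsingle ⊢
    linarith

lemma frequently_rpow_neg_le {ψ : ℝ → ℝ} (hψ : ∀ q : ℝ, 0 < q → 0 < ψ q) {σ : ℝ}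
    (hpos : liminf (fun q : ℝ => -Real.log (ψ q) / Real.log q) atTop ≠ 0)
    (hσ : liminf (fun q : ℝ => -Real.log (ψ q) / Real.log q) atTop < σ) :
    ∃ᶠ q : ℝ in atTop, q ^ (-σ) ≤ ψ q := by
  by_contra hcon
  rw [not_frequently] at hcon
  have hev : ∀ᶠ q : ℝ in atTop, σ ≤ -Real.log (ψ q) / Real.log q := by
    filter_upwards [hcon, eventually_gt_atTop 1] with q hq hq1
    rw [le_div_iff₀ (Real.log_pos hq1)]
    have := Real.log_lt_log (hψ q (by linarith)) (not_le.1 hq)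
    rw [Real.log_rpow (by linarith)] at this
    linarith
  by_cases hbdd : BddAbove {y | ∀ᶠ q : ℝ in atTop, y ≤ -Real.log (ψ q) / Real.log q}
  · have : σ ≤ liminf (fun q : ℝ => -Real.log (ψ q) / Real.log q) atTop := by
      rw [liminf_eq]
      exact le_csSup hbdd hev
    linarith
  · rw [liminf_eq, Real.sSup_of_not_bddAbove hbdd] at hpos
    exact hpos rfl

lemma infinite_setOf_of_mem_iInter_approximableSet {n : ℕ} {f : Fin n → ℝ → ℝ} {lam ψ : ℝ → ℝ}
    {x : ℝ} (hx : x ∈ ⋂ N, approximableSet f lam ψ N) :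
    {c : Fin n → ℤ | c ≠ 0 ∧ nearestIntDist ((∑ i, (c i : ℝ) * f i x) + lam x) <
      ψ ((Finset.univ.sup fun i => (c i).natAbs : ℕ) : ℝ)}.Infinite := by
  intro hfin
  obtain ⟨N, hN⟩ := (hfin.image fun c => Finset.univ.sup fun i => (c i).natAbs).bddAbove
  obtain ⟨c, hc, hlt⟩ := mem_iInter.1 hx N
  refine absurd (hN ⟨c, ⟨?_, hlt⟩, rfl⟩) (not_le.2 hc)
  rintro rfl
  have : (Finset.univ.sup fun i : Fin n => ((0 : Fin n → ℤ) i).natAbs) = 0 :=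
    Nat.le_zero.1 (Finset.sup_le fun i _ => by simp)
  omega

theorem stmt_1 (n : ℕ) (hn : 1 ≤ n) (a b : ℝ) (hab : a < b)
    (f : Fin n → ℝ → ℝ) (hf : ∀ i, ContDiffOn ℝ n (f i) (Icc a b))
    (hW : ∀ x ∈ Icc a b,
      (Matrix.of fun i j : Fin n =>
        iteratedDerivWithin ((j : ℕ) + 1) (f i) (Icc a b) x).det ≠ 0)
    (ψ : ℝ → ℝ) (hψpos : ∀ q : ℝ, 0 < q → 0 < ψ q)
    (hψdec : AntitoneOn ψ (Ioi 0))
    (τ : ℝ) (hτ : τ = liminf (fun q : ℝ => -Real.log (ψ q) / Real.log q) atTop)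
    (hτn : (n : ℝ) ≤ τ)
    (lam : ℝ → ℝ) (hlam : ContDiffOn ℝ 2 lam (Icc a b)) :
    ENNReal.ofReal (((n : ℝ) + 1) / (τ + 1)) ≤
      dimH {x ∈ Icc a b |
        {c : Fin n → ℤ | c ≠ 0 ∧
          nearestIntDist ((∑ i, (c i : ℝ) * f i x) + lam x) <
            ψ ((Finset.univ.sup fun i => (c i).natAbs : ℕ) : ℝ)}.Infinite} := by
  have hτ1 : (1 : ℝ) ≤ τ := le_trans (by exact_mod_cast hn) hτn
  have hu : UniqueDiffOn ℝ (Icc a b) := uniqueDiffOn_Icc hab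
  obtain ⟨x₀, hx₀⟩ := nonempty_Ioo.2 hab
  have hx₀' := hW x₀ (Ioo_subset_Icc_self hx₀)
  have hnhds : Icc a b ∈ nhds x₀ := Icc_mem_nhds hx₀.1 hx₀.2
  obtain ⟨K, hK⟩ := exists_eventually_nondegenerateOn hx₀ hf hx₀'
  set d : Fin n → ℕ → ℝ → ℝ := fun i j => iteratedDerivWithin j (f i) (Icc a b) with hd
  have hcont : ∀ i, ContinuousAt (d i 1) x₀ := fun i =>
    ((hf i).continuousOn_iteratedDerivWithin (by exact_mod_cast hn) hu).continuousAt hnhds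
  obtain ⟨k, hk⟩ : ∃ k, d k 1 x₀ ≠ 0 := by
    by_contra! h
    exact hx₀' (Matrix.det_eq_zero_of_column_eq_zero ⟨0, hn⟩ fun i => h i)
  obtain ⟨s, hs, hsk⟩ : ∃ s : ℝ, |s| = 1 ∧ 0 < s * d k 1 x₀ := by
    rcases hk.lt_or_gt with h | h
    · exact ⟨-1, by simp, by linarith⟩
    · exact ⟨1, by simp, by linarith⟩
  have hlam' : ContinuousAt (derivWithin lam (Icc a b)) x₀ :=
    (hlam.continuousOn_derivWithin hu one_le_two).continuousAt hnhds
  have hB : ∀ᶠ x in nhds x₀, ∀ i, |d i 1 x| ≤ ∑ i, (|d i 1 x₀| + 1) := by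
    refine eventually_all.2 fun i => ?_
    filter_upwards [(hcont i).abs.eventually (gt_mem_nhds (lt_add_one _))] with x hx
    exact hx.le.trans (Finset.single_le_sum (f := fun i => |d i 1 x₀| + 1)
      (fun i _ => by positivity) (Finset.mem_univ i))
  have hμ : ∀ᶠ x in nhds x₀, s * d k 1 x₀ / 2 < s * d k 1 x :=
    ((hcont k).const_mul s).eventually (lt_mem_nhds (half_lt_self hsk))
  obtain ⟨r, hdr, hBr, hμr, hLr, hIr, hr0, hr2⟩ := (hK.and
    ((eventually_forall_mem_closedBall hB).and
    ((eventually_forall_mem_closedBall hμ).and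
    ((eventually_forall_mem_closedBall
      (hlam'.abs.eventually (gt_mem_nhds (lt_add_one _)))).and
    ((eventually_forall_mem_closedBall (isOpen_Ioo.mem_nhds hx₀)).and
    (eventually_mem_set.2 (Ioc_mem_nhdsGT (one_half_pos (α := ℝ))))))))).exists
  have main : ∀ τ' > τ, ENNReal.ofReal (((n : ℝ) + 1) / (τ' + 1)) ≤
      dimH {x ∈ Icc a b |
        {c : Fin n → ℤ | c ≠ 0 ∧
          nearestIntDist ((∑ i, (c i : ℝ) * f i x) + lam x) <
            ψ ((Finset.univ.sup fun i => (c i).natAbs : ℕ) : ℝ)}.Infinite} := by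
    intro τ' hτ'
    have hfreq := frequently_rpow_neg_le hψpos (σ := (τ + τ') / 2) (by rw [← hτ]; positivity)
      (by rw [← hτ]; linarith)
    refine (hdr.le_dimH (lam := lam) hn hr0 hr2 (fun x hx => ?_) (fun i x hx => hBr x hx i)
      (fun x hx => (hLr x hx).le) k hs (half_pos hsk) (fun x hx => (hμr x hx).le) hψdec
      (by linarith : (τ + τ') / 2 < τ') (hτn.trans hτ'.le) hfreq).trans (dimH_mono ?_)
    · exact ((hlam.differentiableOn two_ne_zero) x
        (Ioo_subset_Icc_self (hIr x hx))).hasDerivWithinAt.hasDerivAt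
        (Icc_mem_nhds (hIr x hx).1 (hIr x hx).2)
    · rintro x ⟨hxb, hx⟩
      refine ⟨Ioo_subset_Icc_self (hIr x (Metric.closedBall_subset_closedBall ?_ hxb)), ?_⟩
      · refine div_le_self (le_of_lt hr0) (le_add_of_nonneg_left (by positivity))
      · simpa only [hd, iteratedDerivWithin_zero] using
          infinite_setOf_of_mem_iInter_approximableSet hx
  have hlim : Tendsto (fun τ' : ℝ => ENNReal.ofReal (((n : ℝ) + 1) / (τ' + 1)))
      (nhdsWithin τ (Ioi τ)) (nhds (ENNReal.ofReal (((n : ℝ) + 1) / (τ + 1)))) := by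
    refine ENNReal.tendsto_ofReal (ContinuousAt.tendsto ?_ |>.mono_left nhdsWithin_le_nhds)
    exact continuousAt_const.div (by fun_prop) (by positivity)
  exact le_of_tendsto hlim (eventually_nhdsWithin_of_forall main)
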